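/- arXiv:1107.4791 — 5 statements merged into one kernel-verified Lean document; each statement's English description precedes it below -/
import Mathlib

section
/- Let λ > 0 and let y be a nontrivial real-valued solution on [0,1] of the equation [y‴ − λPy]′ + λPy′ = 0 which for some point a ∈ [0,1) satisfies y(a) ≥ 0, y′(a) ≥ 0, y″(a) ≥ 0 and y‴(a) ≥ 0. Then y(1) > 0, y′(1) > 0, y″(1) > 0 and y‴(1) > 0. -/
open Set Filter

/-- First derivative on `[0,1]` (one-sided at the endpoints). -/
noncomputable def Y1 (y : ℝ → ℝ) : ℝ → ℝ := derivWithin y (Set.Icc 0 1)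
/-- Second derivative on `[0,1]`. -/
noncomputable def Y2 (y : ℝ → ℝ) : ℝ → ℝ := iteratedDerivWithin 2 y (Set.Icc 0 1)
/-- Third derivative on `[0,1]`. -/
noncomputable def Y3 (y : ℝ → ℝ) : ℝ → ℝ := iteratedDerivWithin 3 y (Set.Icc 0 1)

/-- `y` is a solution on `[0,1]` of `[y''' - λ P y]' + λ P y' = 0`:
`y ∈ C³[0,1]` and `y''' - λ P y` is (continuously) differentiable on `[0,1]`
with derivative `-λ P y'`. -/
def SolutionOn (P : ℝ → ℝ) (lam : ℝ) (y : ℝ → ℝ) : Prop :=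
  ContDiffOn ℝ 3 y (Set.Icc 0 1) ∧
  ∀ x ∈ Set.Icc (0:ℝ) 1,
    HasDerivWithinAt (fun t => Y3 y t - lam * P t * y t)
      (-(lam * P x * Y1 y x)) (Set.Icc 0 1) x

/-- `y` is not identically zero on `[0,1]`. -/
def Nontrivial01 (y : ℝ → ℝ) : Prop := ∃ x ∈ Set.Icc (0:ℝ) 1, y x ≠ 0

/-- The boundary conditions of the problem `(α, β)`. -/
def BC (α β : ℝ) (y : ℝ → ℝ) : Prop :=
  Y2 y 0 + α * y 0 - β * Y1 y 0 = 0 ∧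
  -β * Y3 y 0 + α * Y2 y 0 = 0 ∧
  Y2 y 1 + α * y 1 + β * Y1 y 1 = 0 ∧
  -β * Y3 y 1 - α * Y2 y 1 = 0

/-- `y` is an eigenfunction of the problem `(α, β)` with eigenvalue `lam`. -/
def Eigenfunction (P : ℝ → ℝ) (α β lam : ℝ) (y : ℝ → ℝ) : Prop :=
  Nontrivial01 y ∧ SolutionOn P lam y ∧ BC α β y

/-- `lam` is an eigenvalue of the problem `(α, β)`. -/
def IsEigenvalue (P : ℝ → ℝ) (α β lam : ℝ) : Prop :=
  ∃ y : ℝ → ℝ, Eigenfunction P α β lam y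

/-- The number `b = (1 - κ a)/(κ - 1)`. -/
noncomputable def bb (κ : ℕ) (a : ℝ) : ℝ := (1 - κ * a) / (κ - 1)

/-- `P` is a nondecreasing continuous function on `[0,1]` with `P 0 = 0`, `P 1 = 1`,
self-similar of Cantor type with parameters `κ ≥ 2` and `0 < a < 1/κ`. -/
def CantorSelfSimilar (P : ℝ → ℝ) (κ : ℕ) (a : ℝ) : Prop :=
  ContinuousOn P (Set.Icc 0 1) ∧ MonotoneOn P (Set.Icc 0 1) ∧
  P 0 = 0 ∧ P 1 = 1 ∧ 2 ≤ κ ∧ 0 < a ∧ a < 1 / κ ∧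
  (∀ k : ℕ, k < κ → ∃ c : ℝ, ∀ x ∈ Set.Icc (0:ℝ) 1,
      (κ : ℝ) * P (k * (a + bb κ a) + a * x) = P x + c) ∧
  (∀ k : ℕ, 1 ≤ k → k < κ →
      ∀ x ∈ Set.Ioo ((k:ℝ) * (a + bb κ a) - bb κ a) ((k:ℝ) * (a + bb κ a)),
      ∀ x' ∈ Set.Ioo ((k:ℝ) * (a + bb κ a) - bb κ a) ((k:ℝ) * (a + bb κ a)),
      P x = P x')

lemma SolutionOn.hasDerivWithinAt_iterated {P : ℝ → ℝ} {lam : ℝ} {y : ℝ → ℝ}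
    (hy : SolutionOn P lam y) (n : ℕ) (hn : n < 3) {x : ℝ} (hx : x ∈ Icc (0 : ℝ) 1) :
    HasDerivWithinAt (iteratedDerivWithin n y (Icc 0 1))
      (iteratedDerivWithin (n + 1) y (Icc 0 1) x) (Icc 0 1) x := by
  have hd := hy.1.differentiableOn_iteratedDerivWithin (m := n) (by exact_mod_cast hn)
    (uniqueDiffOn_Icc one_pos)
  rw [iteratedDerivWithin_succ]
  exact (hd x hx).hasDerivWithinAt

lemma SolutionOn.hasDerivWithinAt_y {P : ℝ → ℝ} {lam : ℝ} {y : ℝ → ℝ}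
    (hy : SolutionOn P lam y) {x : ℝ} (hx : x ∈ Icc (0 : ℝ) 1) :
    HasDerivWithinAt y (Y1 y x) (Icc 0 1) x := by
  simpa [Y1] using hy.hasDerivWithinAt_iterated 0 (by norm_num) hx

lemma SolutionOn.hasDerivWithinAt_Y1 {P : ℝ → ℝ} {lam : ℝ} {y : ℝ → ℝ}
    (hy : SolutionOn P lam y) {x : ℝ} (hx : x ∈ Icc (0 : ℝ) 1) :
    HasDerivWithinAt (Y1 y) (Y2 y x) (Icc 0 1) x := by
  have h := hy.hasDerivWithinAt_iterated 1 (by norm_num) hx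
  have e : iteratedDerivWithin 1 y (Icc 0 1) = Y1 y := by
    ext t
    simp [Y1, iteratedDerivWithin_one]
  rwa [e] at h

lemma SolutionOn.hasDerivWithinAt_Y2 {P : ℝ → ℝ} {lam : ℝ} {y : ℝ → ℝ}
    (hy : SolutionOn P lam y) {x : ℝ} (hx : x ∈ Icc (0 : ℝ) 1) :
    HasDerivWithinAt (Y2 y) (Y3 y x) (Icc 0 1) x :=
  hy.hasDerivWithinAt_iterated 2 (by norm_num) hx

lemma add_mul_le_of_le_hasDerivWithinAt {f g : ℝ → ℝ} {c s x : ℝ}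
    (hs : 0 ≤ s) (hx : x ≤ 1) (hsx : s ≤ x)
    (hf : ∀ t ∈ Icc s x, HasDerivWithinAt f (g t) (Icc 0 1) t)
    (hg : ∀ t ∈ Icc s x, c ≤ g t) :
    f s + c * (x - s) ≤ f x := by
  have hsub : Icc s x ⊆ Icc (0 : ℝ) 1 := Icc_subset_Icc hs hx
  have hd : ∀ t ∈ interior (Icc s x), HasDerivAt f (g t) t := by
    intro t ht
    rw [interior_Icc] at ht
    exact (hf t (Ioo_subset_Icc_self ht)).hasDerivAt
      (Icc_mem_nhds (hs.trans_lt ht.1) (ht.2.trans_le hx))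
  have := (convex_Icc s x).mul_sub_le_image_sub_of_le_deriv (f := f) (C := c)
    (fun t ht => ((hf t ht).mono hsub).continuousWithinAt)
    (fun t ht => (hd t ht).differentiableAt.differentiableWithinAt)
    (fun t ht => by rw [(hd t ht).deriv]; exact hg t (interior_subset ht))
    s (left_mem_Icc.2 hsx) x (right_mem_Icc.2 hsx) hsx
  linarith

/-- An integral-free form of `y‴(x) - y‴(s) = λ ∫ₛˣ y dP`, in terms of a lower bound for `y′`. -/
lemma SolutionOn.Y3_lower_bound {P : ℝ → ℝ} {lam : ℝ} {y : ℝ → ℝ} {M s x : ℝ}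
    (hy : SolutionOn P lam y) (hlam : 0 < lam) (hP : MonotoneOn P (Icc 0 1))
    (hP0 : P 0 = 0) (hP1 : P 1 = 1)
    (hs : 0 ≤ s) (hx : x ≤ 1) (hsx : s ≤ x) (hM : 0 ≤ M)
    (hb : ∀ t ∈ Icc s x, -M ≤ Y1 y t) :
    Y3 y s + lam * (P x - P s) * y s - lam * M * (x - s) ≤ Y3 y x := by
  have hsub : Icc s x ⊆ Icc (0 : ℝ) 1 := Icc_subset_Icc hs hx
  have hx' : x ∈ Icc (0 : ℝ) 1 := ⟨hs.trans hsx, hx⟩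
  have key := add_mul_le_of_le_hasDerivWithinAt (c := -(lam * M))
    (f := fun t => (Y3 y t - lam * P t * y t) + lam * P x * y t)
    (g := fun t => -(lam * P t * Y1 y t) + lam * P x * Y1 y t) hs hx hsx
    (fun t ht => (hy.2 t (hsub ht)).add ((hy.hasDerivWithinAt_y (hsub ht)).const_mul _))
    (fun t ht => by
      have hle : P t ≤ P x := hP (hsub ht) hx' ht.2
      have hge : 0 ≤ P t := hP0 ▸ hP (left_mem_Icc.2 zero_le_one) (hsub ht) (hsub ht).1
      have hx1 : P x ≤ 1 := hP1 ▸ hP hx' (right_mem_Icc.2 zero_le_one) hx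
      have hu : 0 ≤ (P x - P t) * (Y1 y t + M) :=
        mul_nonneg (by linarith) (by linarith [hb t ht])
      have hv : 0 ≤ (1 - (P x - P t)) * M := mul_nonneg (by linarith) hM
      have : 0 ≤ lam * ((P x - P t) * (Y1 y t + M) + (1 - (P x - P t)) * M) :=
        mul_nonneg hlam.le (by linarith)
      linarith)
  linarith

/-- All four of `y, y′, y″, y‴` are nonnegative at `x`. -/
def NonnegAt (y : ℝ → ℝ) (x : ℝ) : Prop :=
  0 ≤ y x ∧ 0 ≤ Y1 y x ∧ 0 ≤ Y2 y x ∧ 0 ≤ Y3 y x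

lemma SolutionOn.nonnegAt_of_Y1_nonneg {P : ℝ → ℝ} {lam : ℝ} {y : ℝ → ℝ} {s x : ℝ}
    (hy : SolutionOn P lam y) (hlam : 0 < lam) (hP : MonotoneOn P (Icc 0 1))
    (hP0 : P 0 = 0) (hP1 : P 1 = 1) (hs : 0 ≤ s) (hx : x ≤ 1) (hsx : s ≤ x)
    (h : NonnegAt y s) (hb : ∀ t ∈ Icc s x, 0 ≤ Y1 y t) : NonnegAt y x := by
  have hsub : Icc s x ⊆ Icc (0 : ℝ) 1 := Icc_subset_Icc hs hx
  obtain ⟨h0, h1, h2, h3⟩ := h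
  have e3 : ∀ t ∈ Icc s x, 0 ≤ Y3 y t := by
    intro t ht
    have := hy.Y3_lower_bound (M := 0) hlam hP hP0 hP1 hs (ht.2.trans hx) ht.1 le_rfl
      (fun r hr => by simpa using hb r ⟨hr.1, hr.2.trans ht.2⟩)
    have hle : P s ≤ P t := hP (hsub (left_mem_Icc.2 hsx)) (hsub ht) ht.1
    have : 0 ≤ lam * (P t - P s) * y s :=
      mul_nonneg (mul_nonneg hlam.le (by linarith)) h0
    linarith
  have e2 := add_mul_le_of_le_hasDerivWithinAt hs hx hsx
    (fun t ht => hy.hasDerivWithinAt_Y2 (hsub ht)) e3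
  have e0 := add_mul_le_of_le_hasDerivWithinAt hs hx hsx
    (fun t ht => hy.hasDerivWithinAt_y (hsub ht)) hb
  exact ⟨by linarith, hb x (right_mem_Icc.2 hsx), by linarith, e3 x (right_mem_Icc.2 hsx)⟩

lemma SolutionOn.Y1_nonneg_of_short {P : ℝ → ℝ} {lam : ℝ} {y : ℝ → ℝ} {s x : ℝ}
    (hy : SolutionOn P lam y) (hlam : 0 < lam) (hP : MonotoneOn P (Icc 0 1))
    (hP0 : P 0 = 0) (hP1 : P 1 = 1) (hs : 0 ≤ s) (hx : x ≤ 1) (hsx : s ≤ x)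
    (hshort : lam * (x - s) < 1) (h : NonnegAt y s) :
    ∀ t ∈ Icc s x, 0 ≤ Y1 y t := by
  have hsub : Icc s x ⊆ Icc (0 : ℝ) 1 := Icc_subset_Icc hs hx
  obtain ⟨h0, h1, h2, h3⟩ := h
  obtain ⟨p, hp, hmin⟩ := isCompact_Icc.exists_isMinOn (nonempty_Icc.2 hsx)
    (fun t ht => ((hy.hasDerivWithinAt_Y1 (hsub ht)).mono hsub).continuousWithinAt)
  have hmin' : ∀ t ∈ Icc s x, Y1 y p ≤ Y1 y t := fun t ht => hmin ht
  by_contra! hneg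
  obtain ⟨q, hq, hq0⟩ := hneg
  have hp0 : Y1 y p < 0 := (hmin' q hq).trans_lt hq0
  have hδ0 : 0 ≤ x - s := by linarith
  have hδ1 : x - s ≤ 1 := by linarith
  set A := lam * -Y1 y p with hA
  have hA0 : 0 ≤ A := mul_nonneg hlam.le (by linarith)
  have e3 : ∀ t ∈ Icc s x, -(A * (x - s)) ≤ Y3 y t := by
    intro t ht
    have := hy.Y3_lower_bound (M := -Y1 y p) hlam hP hP0 hP1 hs (ht.2.trans hx) ht.1
      (by linarith) (fun r hr => by simpa using hmin' r ⟨hr.1, hr.2.trans ht.2⟩)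
    have hle : P s ≤ P t := hP (hsub (left_mem_Icc.2 hsx)) (hsub ht) ht.1
    have : 0 ≤ lam * (P t - P s) * y s :=
      mul_nonneg (mul_nonneg hlam.le (by linarith)) h0
    have : A * (t - s) ≤ A * (x - s) := mul_le_mul_of_nonneg_left (by linarith [ht.2]) hA0
    linarith
  have step : ∀ r ∈ Icc s x, -(A * (x - s)) ≤ -(A * (x - s)) * (r - s) := by
    intro r hr
    have : A * (x - s) * (r - s) ≤ A * (x - s) * 1 :=
      mul_le_mul_of_nonneg_left (by linarith [hr.2]) (mul_nonneg hA0 hδ0)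
    linarith
  have e2 : ∀ t ∈ Icc s x, -(A * (x - s)) ≤ Y2 y t := by
    intro t ht
    have := add_mul_le_of_le_hasDerivWithinAt hs (ht.2.trans hx) ht.1
      (fun r hr => hy.hasDerivWithinAt_Y2 (hsub ⟨hr.1, hr.2.trans ht.2⟩))
      (fun r hr => e3 r ⟨hr.1, hr.2.trans ht.2⟩)
    linarith [step t ht]
  have e1 := add_mul_le_of_le_hasDerivWithinAt hs (hp.2.trans hx) hp.1
      (fun r hr => hy.hasDerivWithinAt_Y1 (hsub ⟨hr.1, hr.2.trans hp.2⟩))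
      (fun r hr => e2 r ⟨hr.1, hr.2.trans hp.2⟩)
  have hlt : lam * (x - s) * -Y1 y p < 1 * -Y1 y p :=
    mul_lt_mul_of_pos_right hshort (by linarith)
  have := step p hp
  rw [hA] at *
  linarith

lemma SolutionOn.continuousOn_Y3 {P : ℝ → ℝ} {lam : ℝ} {y : ℝ → ℝ}
    (hy : SolutionOn P lam y) : ContinuousOn (Y3 y) (Icc 0 1) :=
  hy.1.continuousOn_iteratedDerivWithin (by norm_num) (uniqueDiffOn_Icc one_pos)

lemma SolutionOn.nonnegAt_of_nonnegAt {P : ℝ → ℝ} {lam : ℝ} {y : ℝ → ℝ} {s : ℝ}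
    (hy : SolutionOn P lam y) (hlam : 0 < lam) (hP : MonotoneOn P (Icc 0 1))
    (hP0 : P 0 = 0) (hP1 : P 1 = 1) (hs : 0 ≤ s) (h : NonnegAt y s) :
    ∀ x ∈ Icc s 1, NonnegAt y x := by
  have hsub : Icc s 1 ⊆ Icc (0 : ℝ) 1 := Icc_subset_Icc_left hs
  have hclosed : ∀ {f : ℝ → ℝ}, ContinuousOn f (Icc 0 1) →
      IsClosed (Icc s 1 ∩ f ⁻¹' Ici 0) :=
    fun hf => (hf.mono hsub).preimage_isClosed_of_isClosed isClosed_Icc isClosed_Ici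
  refine IsClosed.Icc_subset_of_forall_exists_gt (s := {x | NonnegAt y x}) ?_ h ?_
  · have hc := ((hclosed hy.1.continuousOn).inter
      (hclosed fun t ht => (hy.hasDerivWithinAt_Y1 ht).continuousWithinAt)).inter
      ((hclosed fun t ht => (hy.hasDerivWithinAt_Y2 ht).continuousWithinAt).inter
      (hclosed hy.continuousOn_Y3))
    convert hc using 1
    ext t
    simp only [NonnegAt, mem_inter_iff, mem_ofPred_eq, mem_preimage, mem_Ici]
    tauto
  · rintro t ⟨ht, ht1⟩ z hz
    have hz' : t < z := hz
    obtain ⟨δ, hδ0, hδ⟩ : ∃ δ > 0, lam * δ < 1 :=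
      ⟨1 / (2 * lam), by positivity, by field_simp; norm_num⟩
    have hlt : t < min (min z 1) (t + δ) := by
      simp only [lt_min_iff]
      exact ⟨⟨hz', ht1.2⟩, by linarith⟩
    set r := min (min z 1) (t + δ)
    have hr1 : r ≤ 1 := (min_le_left _ _).trans (min_le_right _ _)
    have hrδ : r ≤ t + δ := min_le_right _ _
    have ht0 : 0 ≤ t := hs.trans ht1.1
    have hshort : lam * (r - t) < 1 :=
      (mul_le_mul_of_nonneg_left (by linarith) hlam.le).trans_lt hδ
    exact ⟨r, hy.nonnegAt_of_Y1_nonneg hlam hP hP0 hP1 ht0 hr1 hlt.le ht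
      (hy.Y1_nonneg_of_short hlam hP hP0 hP1 ht0 hr1 hlt.le hshort ht),
      hlt, (min_le_left _ _).trans (min_le_left _ _)⟩

lemma CantorSelfSimilar.lt_one {P : ℝ → ℝ} {κ : ℕ} {a : ℝ}
    (hP : CantorSelfSimilar P κ a) {x : ℝ} (hx : x ∈ Ico (0 : ℝ) 1) : P x < 1 := by
  obtain ⟨-, hmono, hP0, hP1, hκ, ha0, haκ, hself, -⟩ := hP
  have hκ2 : (2 : ℝ) ≤ κ := by exact_mod_cast hκ
  have ha1 : a < 1 := haκ.trans_le (by rw [div_le_one (by linarith)]; linarith)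
  have hpow : ∀ n : ℕ, a ^ n ∈ Icc (0 : ℝ) 1 := fun n =>
    ⟨by positivity, pow_le_one₀ ha0.le ha1.le⟩
  obtain ⟨c, hc⟩ := hself (κ - 1) (by omega)
  have hend : ∀ u : ℝ, ((κ - 1 : ℕ) : ℝ) * (a + bb κ a) + a * (1 - u) = 1 - a * u := by
    intro u
    have hne : (κ : ℝ) - 1 ≠ 0 := by linarith
    rw [Nat.cast_sub (by omega), bb]
    field_simp
    push_cast
    ring
  have hc1 := hc 1 (right_mem_Icc.2 zero_le_one)
  have hend0 := hend 0
  simp only [sub_zero, mul_zero] at hend0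
  rw [hend0, hP1] at hc1
  have hlt : ∀ n : ℕ, P (1 - a ^ n) < 1 := by
    intro n
    induction n with
    | zero => simp [hP0]
    | succ n ih =>
      have h := hc (1 - a ^ n) ⟨by linarith [(hpow n).2], by linarith [(hpow n).1]⟩
      rw [hend, ← pow_succ'] at h
      nlinarith
  obtain ⟨n, hn⟩ := exists_pow_lt_of_lt_one (sub_pos.2 hx.2) ha1
  exact (hmono ⟨hx.1, hx.2.le⟩ ⟨by linarith [(hpow n).2], by linarith [(hpow n).1]⟩
    (by linarith)).trans_lt (hlt n)

lemma eqOn_zero_of_hasDerivWithinAt {f g : ℝ → ℝ} {s : ℝ} (hs : 0 ≤ s)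
    (hf : ∀ t ∈ Icc (0 : ℝ) 1, HasDerivWithinAt f (g t) (Icc 0 1) t)
    (h : ∀ t ∈ Ico s 1, f t = 0) : ∀ t ∈ Ico s 1, g t = 0 := by
  intro t ht
  have hsub : Ico s 1 ⊆ Icc (0 : ℝ) 1 := fun r hr => ⟨hs.trans hr.1, hr.2.le⟩
  have h1 := (hf t (hsub ht)).mono hsub
  have h2 : HasDerivWithinAt f 0 (Ico s 1) t :=
    (hasDerivWithinAt_const t (Ico s 1) (0 : ℝ)).congr h (h t ht)
  exact (uniqueDiffOn_Ico s 1 t ht).eq_deriv _ h1 h2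

lemma pos_of_hasDerivWithinAt_pos {f g : ℝ → ℝ} {s : ℝ} (hs : s ∈ Ico (0 : ℝ) 1)
    (hf : ∀ t ∈ Icc (0 : ℝ) 1, HasDerivWithinAt f (g t) (Icc 0 1) t)
    (hf0 : ∀ t ∈ Icc s 1, 0 ≤ f t) (hg0 : ∀ t ∈ Icc s 1, 0 ≤ g t) (hg : 0 < g 1) :
    0 < f 1 := by
  by_contra! hle
  have hsub : Icc s 1 ⊆ Icc (0 : ℝ) 1 := Icc_subset_Icc_left hs.1
  have hz : ∀ t ∈ Icc s 1, f t = 0 := by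
    intro t ht
    have := add_mul_le_of_le_hasDerivWithinAt (hs.1.trans ht.1) le_rfl ht.2
      (fun r hr => hf r (hsub ⟨ht.1.trans hr.1, hr.2⟩))
      (fun r hr => hg0 r ⟨ht.1.trans hr.1, hr.2⟩)
    linarith [hf0 t ht]
  have h1 : (1 : ℝ) ∈ Icc s 1 := right_mem_Icc.2 hs.2.le
  have h2 : HasDerivWithinAt f 0 (Icc s 1) 1 :=
    (hasDerivWithinAt_const 1 (Icc s 1) (0 : ℝ)).congr hz (hz 1 h1)
  exact hg.ne' ((uniqueDiffOn_Icc hs.2 1 h1).eq_deriv _ ((hf 1 (hsub h1)).mono hsub) h2)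

/-- The right-hand side of the first order system for `(y, y′, y″, y‴ - λPy)`. -/
def firstOrderField (P : ℝ → ℝ) (lam t : ℝ) (p : ℝ × ℝ × ℝ × ℝ) : ℝ × ℝ × ℝ × ℝ :=
  (p.2.1, p.2.2.1, p.2.2.2 + lam * P t * p.1, -(lam * P t * p.2.1))

lemma lipschitzWith_firstOrderField {P : ℝ → ℝ} {lam t : ℝ} (hlam : 0 < lam)
    (h0 : 0 ≤ P t) (h1 : P t ≤ 1) :
    LipschitzWith (1 + lam).toNNReal (firstOrderField P lam t) := by
  refine LipschitzWith.of_dist_le_mul fun p q => ?_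
  rw [Real.coe_toNNReal _ (by linarith)]
  have hp1 : |p.1 - q.1| ≤ dist p q := by
    rw [← Real.dist_eq]; exact le_max_left _ _
  have hr : dist p.2 q.2 ≤ dist p q := le_max_right _ _
  have hp2 : |p.2.1 - q.2.1| ≤ dist p q := by
    rw [← Real.dist_eq]; exact (le_max_left _ _).trans hr
  have hr' : dist p.2.2 q.2.2 ≤ dist p q := le_trans (le_max_right _ _) hr
  have hp3 : |p.2.2.1 - q.2.2.1| ≤ dist p q := by
    rw [← Real.dist_eq]; exact (le_max_left _ _).trans hr'
  have hp4 : |p.2.2.2 - q.2.2.2| ≤ dist p q := by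
    rw [← Real.dist_eq]; exact (le_max_right _ _).trans hr'
  have hd : 0 ≤ dist p q := dist_nonneg
  have hc0 : 0 ≤ lam * P t := mul_nonneg hlam.le h0
  have hc1 : lam * P t ≤ lam := by nlinarith
  have hld : 0 ≤ lam * dist p q := mul_nonneg hlam.le hd
  have hmul : ∀ z : ℝ, |z| ≤ dist p q → |lam * P t * z| ≤ lam * dist p q := by
    intro z hz
    rw [abs_mul, abs_of_nonneg hc0]
    exact mul_le_mul hc1 hz (abs_nonneg _) hlam.le
  simp only [firstOrderField]
  rw [Prod.dist_eq, Prod.dist_eq, Prod.dist_eq]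
  simp only [Real.dist_eq, max_le_iff]
  refine ⟨by linarith, by linarith, ?_, ?_⟩
  · have e : p.2.2.2 + lam * P t * p.1 - (q.2.2.2 + lam * P t * q.1)
        = (p.2.2.2 - q.2.2.2) + lam * P t * (p.1 - q.1) := by ring
    rw [e]
    linarith [abs_add_le (p.2.2.2 - q.2.2.2) (lam * P t * (p.1 - q.1)), hmul _ hp1]
  · have e : -(lam * P t * p.2.1) - -(lam * P t * q.2.1)
        = -(lam * P t * (p.2.1 - q.2.1)) := by ring
    rw [e, abs_neg]
    linarith [hmul _ hp2]

lemma SolutionOn.eqOn_zero {P : ℝ → ℝ} {lam : ℝ} {y : ℝ → ℝ} {s : ℝ}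
    (hy : SolutionOn P lam y) (hlam : 0 < lam) (hP : MonotoneOn P (Icc 0 1))
    (hP0 : P 0 = 0) (hP1 : P 1 = 1) (hs : s ∈ Icc (0 : ℝ) 1)
    (h0 : y s = 0) (h1 : Y1 y s = 0) (h2 : Y2 y s = 0) (h3 : Y3 y s = 0) :
    ∀ x ∈ Icc (0 : ℝ) 1, y x = 0 := by
  set F : ℝ → ℝ × ℝ × ℝ × ℝ := fun t => (y t, Y1 y t, Y2 y t, Y3 y t - lam * P t * y t)
    with hF
  have hFs : F s = 0 := by simp [hF, h0, h1, h2, h3]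
  have hd : ∀ t ∈ Icc (0 : ℝ) 1,
      HasDerivWithinAt F (firstOrderField P lam t (F t)) (Icc 0 1) t := by
    intro t ht
    have h := (hy.hasDerivWithinAt_y ht).prodMk ((hy.hasDerivWithinAt_Y1 ht).prodMk
      ((hy.hasDerivWithinAt_Y2 ht).prodMk (hy.2 t ht)))
    have e : Y3 y t - lam * P t * y t + lam * P t * y t = Y3 y t := by ring
    simpa [firstOrderField, hF, e] using h
  have hc : ContinuousOn F (Icc 0 1) := fun t ht => (hd t ht).continuousWithinAt
  have hlip : ∀ t ∈ Icc (0 : ℝ) 1,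
      LipschitzOnWith (1 + lam).toNNReal (firstOrderField P lam t) univ := fun t ht =>
    (lipschitzWith_firstOrderField hlam
      (hP0 ▸ hP (left_mem_Icc.2 zero_le_one) ht ht.1)
      (hP1 ▸ hP ht (right_mem_Icc.2 zero_le_one) ht.2)).lipschitzOnWith
  have hzero : ∀ t, firstOrderField P lam t 0 = 0 := fun t => by simp [firstOrderField]
  have hright : EqOn F (fun _ => 0) (Icc s 1) :=
    ODE_solution_unique_of_mem_Icc_right (v := firstOrderField P lam) (s := fun _ => univ)
      (fun t ht => hlip t ⟨hs.1.trans ht.1, ht.2.le⟩)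
      (hc.mono (Icc_subset_Icc_left hs.1))
      (fun t ht => (hd t ⟨hs.1.trans ht.1, ht.2.le⟩).mono_of_mem_nhdsWithin
        (mem_of_superset (Ico_mem_nhdsGE ht.2)
          fun r hr => ⟨hs.1.trans (ht.1.trans hr.1), hr.2.le⟩))
      (fun _ _ => mem_univ _) continuousOn_const
      (fun t _ => by rw [hzero]; exact hasDerivWithinAt_const _ _ _)
      (fun _ _ => mem_univ _) hFs
  have hleft : EqOn F (fun _ => 0) (Icc 0 s) :=
    ODE_solution_unique_of_mem_Icc_left (v := firstOrderField P lam) (s := fun _ => univ)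
      (fun t ht => hlip t ⟨ht.1.le, ht.2.trans hs.2⟩)
      (hc.mono (Icc_subset_Icc_right hs.2))
      (fun t ht => (hd t ⟨ht.1.le, ht.2.trans hs.2⟩).mono_of_mem_nhdsWithin
        (mem_of_superset (Ioc_mem_nhdsLE ht.1)
          fun r hr => ⟨hr.1.le, hr.2.trans (ht.2.trans hs.2)⟩))
      (fun _ _ => mem_univ _) continuousOn_const
      (fun t _ => by rw [hzero]; exact hasDerivWithinAt_const _ _ _)
      (fun _ _ => mem_univ _) hFs
  intro x hx
  rcases le_total x s with h | h
  · exact congrArg Prod.fst (hleft ⟨hx.1, h⟩)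
  · exact congrArg Prod.fst (hright ⟨h, hx.2⟩)

theorem stmt0 (P : ℝ → ℝ) (κ : ℕ) (a : ℝ) (hP : CantorSelfSimilar P κ a)
    (lam : ℝ) (hlam : 0 < lam) (y : ℝ → ℝ)
    (hy : SolutionOn P lam y) (hnt : Nontrivial01 y)
    (t0 : ℝ) (ht0 : t0 ∈ Set.Ico (0:ℝ) 1)
    (h0 : 0 ≤ y t0) (h1 : 0 ≤ Y1 y t0) (h2 : 0 ≤ Y2 y t0) (h3 : 0 ≤ Y3 y t0) :
    0 < y 1 ∧ 0 < Y1 y 1 ∧ 0 < Y2 y 1 ∧ 0 < Y3 y 1 := by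
  have hlt := fun {x} => hP.lt_one (x := x)
  obtain ⟨-, hmono, hP0, hP1, -⟩ := hP
  have hnn := hy.nonnegAt_of_nonnegAt hlam hmono hP0 hP1 ht0.1 ⟨h0, h1, h2, h3⟩
  obtain ⟨m, hm, hym⟩ : ∃ m ∈ Ico t0 1, 0 < y m := by
    by_contra! hle
    have z0 : ∀ t ∈ Ico t0 1, y t = 0 := fun t ht =>
      le_antisymm (hle t ht) (hnn t ⟨ht.1, ht.2.le⟩).1
    have z1 := eqOn_zero_of_hasDerivWithinAt ht0.1 (fun t ht => hy.hasDerivWithinAt_y ht) z0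
    have z2 := eqOn_zero_of_hasDerivWithinAt ht0.1 (fun t ht => hy.hasDerivWithinAt_Y1 ht) z1
    have z3 := eqOn_zero_of_hasDerivWithinAt ht0.1 (fun t ht => hy.hasDerivWithinAt_Y2 ht) z2
    have hmem := left_mem_Ico.2 ht0.2
    obtain ⟨x, hx, hyx⟩ := hnt
    exact hyx (hy.eqOn_zero hlam hmono hP0 hP1 ⟨ht0.1, ht0.2.le⟩
      (z0 _ hmem) (z1 _ hmem) (z2 _ hmem) (z3 _ hmem) x hx)
  have hm0 : 0 ≤ m := ht0.1.trans hm.1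
  have p3 : 0 < Y3 y 1 := by
    have hb := hy.Y3_lower_bound (M := 0) hlam hmono hP0 hP1 hm0 le_rfl hm.2.le le_rfl
      (fun r hr => by simpa using (hnn r ⟨hm.1.trans hr.1, hr.2⟩).2.1)
    have hpos : 0 < lam * (P 1 - P m) * y m :=
      mul_pos (mul_pos hlam (by linarith [hlt ⟨hm0, hm.2⟩])) hym
    linarith [(hnn m ⟨hm.1, hm.2.le⟩).2.2.2]
  have p2 : 0 < Y2 y 1 := pos_of_hasDerivWithinAt_pos ht0
    (fun t ht => hy.hasDerivWithinAt_Y2 ht) (fun t ht => (hnn t ht).2.2.1)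
    (fun t ht => (hnn t ht).2.2.2) p3
  have p1 : 0 < Y1 y 1 := pos_of_hasDerivWithinAt_pos ht0
    (fun t ht => hy.hasDerivWithinAt_Y1 ht) (fun t ht => (hnn t ht).2.1)
    (fun t ht => (hnn t ht).2.2.1) p2
  exact ⟨pos_of_hasDerivWithinAt_pos ht0 (fun t ht => hy.hasDerivWithinAt_y ht)
    (fun t ht => (hnn t ht).1) (fun t ht => (hnn t ht).2.1) p1, p1, p2, p3⟩
end

section
/- Let P : ℝ → ℝ be any nondecreasing continuous function on [0,1], let λ > 0, and let y be a nontrivial real-valued solution on [0,1] of the equation [y‴ − λPy]′ + λPy′ = 0 which for some point a ∈ [0,1) satisfies y(a) ≥ 0, y′(a) ≥ 0, y″(a) ≥ 0 and y‴(a) ≥ 0. Then each of the functions y, y′, y″, y‴ is nonnegative on the half-open interval (a,1], and for every x ∈ (a,1) one has y‴(1) ≥ λ·(P(1) − P(x))·y(x). -/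
open Set Filter

/-- A function with nonnegative derivative on `[a, b]` does not decrease from `a` to `b`. -/
theorem le_of_hasDerivWithinAt_nonneg {f f' : ℝ → ℝ} {a b : ℝ} (hab : a ≤ b)
    (hf : ∀ t ∈ Icc a b, HasDerivWithinAt f (f' t) (Icc a b) t)
    (hf' : ∀ t ∈ Icc a b, 0 ≤ f' t) : f a ≤ f b := by
  refine monotoneOn_of_hasDerivWithinAt_nonneg (f' := f') (convex_Icc a b)
    (fun t ht => (hf t ht).continuousWithinAt)
    (fun t ht => (hf t (interior_subset ht)).mono interior_subset)
    (fun t ht => hf' t (interior_subset ht)) (left_mem_Icc.2 hab) (right_mem_Icc.2 hab) hab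

/-- An exponential lower bound on the derivative integrates to one on the function. -/
theorem neg_exp_le_of_hasDerivWithinAt {f f' : ℝ → ℝ} {a b c K : ℝ} (hab : a ≤ b)
    (hc : 0 ≤ c) (hK : 0 < K) (hf : ∀ t ∈ Icc a b, HasDerivWithinAt f (f' t) (Icc a b) t)
    (hf' : ∀ t ∈ Icc a b, -(c * Real.exp (K * t)) ≤ f' t) (ha : 0 ≤ f a) :
    -(c / K * Real.exp (K * b)) ≤ f b := by
  have hexp : ∀ t, HasDerivAt (fun t => c / K * Real.exp (K * t)) (c * Real.exp (K * t)) t := by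
    intro t
    refine ((((hasDerivAt_id' t).const_mul K).exp).const_mul (c / K)).congr_deriv ?_
    field_simp
  have h := le_of_hasDerivWithinAt_nonneg hab
    (fun t ht => (hf t ht).add (hexp t).hasDerivWithinAt)
    (fun t ht => by linarith [hf' t ht])
  have hpos : 0 ≤ c / K * Real.exp (K * a) := by positivity
  simp only [Pi.add_apply] at h
  linarith

/-- If `u` has derivatives `v`, `w`, `z` and `z - λ P u` has derivative `-λ P v` on `[a, b]`, then
an exponential lower bound on `v` propagates to `z`, `w` and `v`, with `C ≥ λ (P b - P a)`. -/
theorem neg_exp_le_of_quasiDerivative {P u v w z : ℝ → ℝ} {a b lam C K m : ℝ}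
    (hP : MonotoneOn P (Icc a b)) (hlam : 0 ≤ lam) (hC : lam * (P b - P a) ≤ C) (hC0 : 0 ≤ C)
    (hK : 0 < K) (hm : 0 ≤ m)
    (hv : ∀ t ∈ Icc a b, HasDerivWithinAt v (w t) (Icc a b) t)
    (hw : ∀ t ∈ Icc a b, HasDerivWithinAt w (z t) (Icc a b) t)
    (hu : ∀ t ∈ Icc a b, HasDerivWithinAt u (v t) (Icc a b) t)
    (hz : ∀ t ∈ Icc a b,
      HasDerivWithinAt (fun t => z t - lam * P t * u t) (-(lam * P t * v t)) (Icc a b) t)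
    (hua : 0 ≤ u a) (hva : 0 ≤ v a) (hwa : 0 ≤ w a) (hza : 0 ≤ z a)
    (hmv : ∀ t ∈ Icc a b, -(m * Real.exp (K * t)) ≤ v t) {x : ℝ} (hx : x ∈ Icc a b) :
    -(C * m / K * Real.exp (K * x)) ≤ z x ∧ -(C * m / K / K * Real.exp (K * x)) ≤ w x ∧
      -(C * m / K / K / K * Real.exp (K * x)) ≤ v x := by
  have hsub : ∀ {x}, x ∈ Icc a b → Icc a x ⊆ Icc a b := fun hx => Icc_subset_Icc_right hx.2
  have key_z : ∀ x ∈ Icc a b, -(C * m / K * Real.exp (K * x)) ≤ z x := by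
    intro x hx
    have ha : a ∈ Icc a b := left_mem_Icc.2 (hx.1.trans hx.2)
    have hb : b ∈ Icc a b := right_mem_Icc.2 (hx.1.trans hx.2)
    have h := neg_exp_le_of_hasDerivWithinAt (c := C * m) hx.1 (by positivity) hK
      (fun t ht => ((hz t (hsub hx ht)).mono (hsub hx)).add
        (((hu t (hsub hx ht)).mono (hsub hx)).const_mul (lam * P x))) ?_ ?_
    · simp only [Pi.add_apply] at h
      linarith
    · intro t ht
      have h₁ : 0 ≤ lam * (P x - P t) :=
        mul_nonneg hlam (sub_nonneg.2 (hP (hsub hx ht) hx ht.2))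
      have h₂ : lam * (P x - P t) ≤ C := by
        refine le_trans (mul_le_mul_of_nonneg_left ?_ hlam) hC
        linarith [hP ha (hsub hx ht) ht.1, hP hx hb hx.2]
      have h₃ := mul_le_mul_of_nonneg_left (hmv t (hsub hx ht)) h₁
      have h₄ := mul_le_mul_of_nonneg_right h₂ (mul_nonneg hm (Real.exp_pos (K * t)).le)
      linarith
    · have := mul_nonneg (mul_nonneg hlam (sub_nonneg.2 (hP ha hx hx.1))) hua
      simp only [Pi.add_apply]
      linarith
  have key_w : ∀ x ∈ Icc a b, -(C * m / K / K * Real.exp (K * x)) ≤ w x := fun x hx =>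
    neg_exp_le_of_hasDerivWithinAt hx.1 (by positivity) hK
      (fun t ht => (hw t (hsub hx ht)).mono (hsub hx)) (fun t ht => key_z t (hsub hx ht)) hwa
  exact ⟨key_z x hx, key_w x hx, neg_exp_le_of_hasDerivWithinAt hx.1 (by positivity) hK
      (fun t ht => (hv t (hsub hx ht)).mono (hsub hx)) (fun t ht => key_w t (hsub hx ht)) hva⟩

/-- Nonnegative initial data for `[u''' - λ P u]' + λ P u' = 0` with `P` nondecreasing stay
nonnegative. -/
theorem nonneg_of_quasiDerivative {P u v w z : ℝ → ℝ} {a b lam : ℝ} (hab : a ≤ b)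
    (hP : MonotoneOn P (Icc a b)) (hlam : 0 ≤ lam)
    (hv : ∀ t ∈ Icc a b, HasDerivWithinAt v (w t) (Icc a b) t)
    (hw : ∀ t ∈ Icc a b, HasDerivWithinAt w (z t) (Icc a b) t)
    (hu : ∀ t ∈ Icc a b, HasDerivWithinAt u (v t) (Icc a b) t)
    (hz : ∀ t ∈ Icc a b,
      HasDerivWithinAt (fun t => z t - lam * P t * u t) (-(lam * P t * v t)) (Icc a b) t)
    (hua : 0 ≤ u a) (hva : 0 ≤ v a) (hwa : 0 ≤ w a) (hza : 0 ≤ z a) {x : ℝ} (hx : x ∈ Icc a b) :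
    0 ≤ u x ∧ 0 ≤ v x ∧ 0 ≤ w x ∧ 0 ≤ z x := by
  set C := lam * (P b - P a) with hC
  have hC0 : 0 ≤ C :=
    mul_nonneg hlam (sub_nonneg.2 (hP (left_mem_Icc.2 hab) (right_mem_Icc.2 hab) hab))
  set K := C + 1 with hKdef
  have hK : 0 < K := by positivity
  have propagate : ∀ m, 0 ≤ m → (∀ t ∈ Icc a b, -(m * Real.exp (K * t)) ≤ v t) → ∀ x ∈ Icc a b,
      -(C * m / K * Real.exp (K * x)) ≤ z x ∧ -(C * m / K / K * Real.exp (K * x)) ≤ w x ∧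
        -(C * m / K / K / K * Real.exp (K * x)) ≤ v x := fun m hm hmv x hx =>
    neg_exp_le_of_quasiDerivative hP hlam hC.ge hC0 hK hm hv hw hu hz hua hva hwa hza hmv hx
  have hvc : ContinuousOn v (Icc a b) := fun t ht => (hv t ht).continuousWithinAt
  obtain ⟨x₀, hx₀, hmin⟩ := isCompact_Icc.exists_isMinOn (nonempty_Icc.2 hab)
    (f := fun t => v t * Real.exp (-(K * t))) (by fun_prop)
  have hbound : ∀ t ∈ Icc a b, v x₀ * Real.exp (-(K * x₀)) * Real.exp (K * t) ≤ v t := by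
    intro t ht
    have h := mul_le_mul_of_nonneg_right (isMinOn_iff.1 hmin t ht) (Real.exp_pos (K * t)).le
    rwa [mul_assoc (v t), ← Real.exp_add, neg_add_cancel, Real.exp_zero, mul_one] at h
  have hv₀ : 0 ≤ v x₀ := by
    by_contra! hneg
    set m := -(v x₀ * Real.exp (-(K * x₀))) with hm
    have hmpos : 0 < m := by
      have := mul_neg_of_neg_of_pos hneg (Real.exp_pos (-(K * x₀)))
      linarith
    have h := (propagate m hmpos.le (fun t ht => by
      have := hbound t ht
      rw [hm]; linarith) x₀ hx₀).2.2
    have hvx : v x₀ = -(m * Real.exp (K * x₀)) := by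
      rw [hm, neg_mul, neg_neg, mul_assoc, ← Real.exp_add, neg_add_cancel, Real.exp_zero, mul_one]
    rw [hvx, neg_le_neg_iff] at h
    have h' := le_of_mul_le_mul_right h (Real.exp_pos _)
    rw [le_div_iff₀ hK, le_div_iff₀ hK, le_div_iff₀ hK] at h'
    have h₁ : 0 ≤ m * C ^ 2 := by positivity
    have h₂ : 0 ≤ m * C ^ 3 := by positivity
    have h₃ : 0 ≤ m * C := by positivity
    rw [hKdef] at h'
    linarith
  have hvnn : ∀ t ∈ Icc a b, 0 ≤ v t := fun t ht =>
    le_trans (by positivity) (hbound t ht)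
  have h := propagate 0 le_rfl (fun t ht => by simpa using hvnn t ht) x hx
  simp only [mul_zero, zero_div, zero_mul, neg_zero] at h
  have hsub : Icc a x ⊆ Icc a b := Icc_subset_Icc_right hx.2
  exact ⟨hua.trans (le_of_hasDerivWithinAt_nonneg hx.1 (fun t ht => (hu t (hsub ht)).mono hsub)
    (fun t ht => hvnn t (hsub ht))), hvnn x hx, h.2.1, h.1⟩

/-- The iterated derivatives of a `C³` function on `[0, 1]` are successive derivatives. -/
theorem ContDiffOn.hasDerivWithinAt_Y1_Y2_Y3 {y : ℝ → ℝ} (hy : ContDiffOn ℝ 3 y (Icc 0 1))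
    {t : ℝ} (ht : t ∈ Icc (0 : ℝ) 1) :
    HasDerivWithinAt y (Y1 y t) (Icc 0 1) t ∧ HasDerivWithinAt (Y1 y) (Y2 y t) (Icc 0 1) t ∧
      HasDerivWithinAt (Y2 y) (Y3 y t) (Icc 0 1) t := by
  have hs : UniqueDiffOn ℝ (Icc (0 : ℝ) 1) := uniqueDiffOn_Icc zero_lt_one
  have hd : ∀ n : ℕ, n < 3 → HasDerivWithinAt (iteratedDerivWithin n y (Icc 0 1))
      (iteratedDerivWithin (n + 1) y (Icc 0 1) t) (Icc 0 1) t := by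
    intro n hn
    rw [iteratedDerivWithin_succ]
    exact (hy.differentiableOn_iteratedDerivWithin (by exact_mod_cast hn) hs t ht).hasDerivWithinAt
  have h₁ : iteratedDerivWithin 1 y (Icc 0 1) = Y1 y := by
    funext x
    rw [iteratedDerivWithin_one, Y1]
  refine ⟨?_, ?_, hd 2 (by norm_num)⟩
  · have h := hd 0 (by norm_num)
    rwa [iteratedDerivWithin_zero, zero_add, h₁] at h
  · have h := hd 1 (by norm_num)
    rwa [h₁] at h

theorem stmt2 (P : ℝ → ℝ) (hPc : ContinuousOn P (Set.Icc 0 1))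
    (hPm : MonotoneOn P (Set.Icc 0 1))
    (lam : ℝ) (hlam : 0 < lam) (y : ℝ → ℝ)
    (hy : SolutionOn P lam y) (hnt : Nontrivial01 y)
    (t0 : ℝ) (ht0 : t0 ∈ Set.Ico (0:ℝ) 1)
    (h0 : 0 ≤ y t0) (h1 : 0 ≤ Y1 y t0) (h2 : 0 ≤ Y2 y t0) (h3 : 0 ≤ Y3 y t0) :
    (∀ x ∈ Set.Ioc t0 1, 0 ≤ y x ∧ 0 ≤ Y1 y x ∧ 0 ≤ Y2 y x ∧ 0 ≤ Y3 y x) ∧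
    (∀ x ∈ Set.Ioo t0 1, lam * (P 1 - P x) * y x ≤ Y3 y 1) := by
  obtain ⟨hC3, hz⟩ := hy
  have hsub : ∀ {s}, s ∈ Icc t0 1 → Icc s 1 ⊆ Icc (0 : ℝ) 1 := fun hs =>
    Icc_subset_Icc_left (ht0.1.trans hs.1)
  have ht : t0 ∈ Icc t0 1 := left_mem_Icc.2 ht0.2.le
  have hnonneg : ∀ x ∈ Icc t0 1, 0 ≤ y x ∧ 0 ≤ Y1 y x ∧ 0 ≤ Y2 y x ∧ 0 ≤ Y3 y x := fun x hx =>
    nonneg_of_quasiDerivative ht0.2.le (hPm.mono (hsub ht)) hlam.le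
      (fun t h => (hC3.hasDerivWithinAt_Y1_Y2_Y3 (hsub ht h)).2.1.mono (hsub ht))
      (fun t h => (hC3.hasDerivWithinAt_Y1_Y2_Y3 (hsub ht h)).2.2.mono (hsub ht))
      (fun t h => (hC3.hasDerivWithinAt_Y1_Y2_Y3 (hsub ht h)).1.mono (hsub ht))
      (fun t h => (hz t (hsub ht h)).mono (hsub ht)) h0 h1 h2 h3 hx
  refine ⟨fun x hx => hnonneg x (Ioc_subset_Icc_self hx), fun x hx => ?_⟩
  have hx' := Ioo_subset_Icc_self hx
  have h := le_of_hasDerivWithinAt_nonneg hx.2.le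
    (fun t h => ((hz t (hsub hx' h)).mono (hsub hx')).add
      (((hC3.hasDerivWithinAt_Y1_Y2_Y3 (hsub hx' h)).1.mono (hsub hx')).const_mul (lam * P 1)))
    (fun t h => by
      have := mul_nonneg (mul_nonneg hlam.le (sub_nonneg.2
        (hPm (hsub hx' h) (right_mem_Icc.2 zero_le_one) h.2)))
        (hnonneg t ⟨hx.1.le.trans h.1, h.2⟩).2.1
      linarith)
  simp only [Pi.add_apply] at h
  linarith [(hnonneg x hx').2.2.2]
end

section
/- Every eigenvalue λ of the problem (α,β) is nonnegative; moreover, if α > 0, then every eigenvalue of the problem (α,β) is strictly positive. -/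
open Set Filter

/-- If `P` is nondecreasing and `f` is nonnegative and `C¹`, the increments of `P f - ∫ P f'` are
bounded below by an error that is quadratic in the increments. -/
theorem stieltjes_increment_lower_bound {P f f' : ℝ → ℝ} {x z C : ℝ} (hxz : x ≤ z)
    (hPc : ContinuousOn P (Icc x z)) (hPm : MonotoneOn P (Icc x z))
    (hf : ∀ t ∈ Icc x z, HasDerivWithinAt f (f' t) (Icc x z) t)
    (hf'c : ContinuousOn f' (Icc x z)) (hC : ∀ t ∈ Icc x z, |f' t| ≤ C) (hfx : 0 ≤ f x) :
    -(C * (z - x)) * (P z - P x) ≤ P z * f z - P x * f x - ∫ t in x..z, P t * f' t := by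
  have hx : x ∈ Icc x z := left_mem_Icc.2 hxz
  have hz : z ∈ Icc x z := right_mem_Icc.2 hxz
  have hPxz : P x ≤ P z := hPm hx hz hxz
  have hfi : IntervalIntegrable f' MeasureTheory.volume x z :=
    hf'c.intervalIntegrable_of_Icc hxz
  have hPfi : IntervalIntegrable (fun t => P t * f' t) MeasureTheory.volume x z :=
    (hPc.mul hf'c).intervalIntegrable_of_Icc hxz
  have hftc : ∫ t in x..z, f' t = f z - f x :=
    intervalIntegral.integral_eq_sub_of_hasDerivAt_of_le hxz
      (fun t ht => (hf t ht).continuousWithinAt)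
      (fun t ht => (hf t (Ioo_subset_Icc_self ht)).hasDerivAt (Icc_mem_nhds ht.1 ht.2)) hfi
  have hsub : ∫ t in x..z, (P z * f' t - P t * f' t)
      = P z * (f z - f x) - ∫ t in x..z, P t * f' t := by
    rw [intervalIntegral.integral_sub (hfi.const_mul _) hPfi,
      intervalIntegral.integral_const_mul, hftc]
  have hbound : ∫ _t in x..z, -(C * (P z - P x)) ≤ ∫ t in x..z, (P z * f' t - P t * f' t) := by
    refine intervalIntegral.integral_mono_on hxz (by simp) ((hfi.const_mul _).sub hPfi) ?_
    intro t ht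
    have h1 : P x ≤ P t := hPm hx ht ht.1
    have h2 : P t ≤ P z := hPm ht hz ht.2
    have h3 := abs_le.1 (hC t ht)
    nlinarith
  rw [hsub, intervalIntegral.integral_const, smul_eq_mul] at hbound
  nlinarith [mul_nonneg hfx (sub_nonneg.2 hPxz)]

/-- The Stieltjes integral `∫ f dP` of a nonnegative `C¹` function against a continuous
nondecreasing `P`, written via integration by parts, is nonnegative. -/
theorem stieltjes_integral_nonneg {P f f' : ℝ → ℝ}
    (hPc : ContinuousOn P (Icc 0 1)) (hPm : MonotoneOn P (Icc 0 1))
    (hf : ∀ t ∈ Icc (0 : ℝ) 1, HasDerivWithinAt f (f' t) (Icc 0 1) t)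
    (hf'c : ContinuousOn f' (Icc 0 1)) (hf0 : ∀ t ∈ Icc (0 : ℝ) 1, 0 ≤ f t) :
    0 ≤ P 1 * f 1 - P 0 * f 0 - ∫ t in (0 : ℝ)..1, P t * f' t := by
  obtain ⟨C, hC⟩ := isCompact_Icc.exists_bound_of_continuousOn hf'c
  simp only [Real.norm_eq_abs] at hC
  have hint : ∀ u ∈ Icc (0 : ℝ) 1, ∀ v ∈ Icc (0 : ℝ) 1,
      IntervalIntegrable (fun t => P t * f' t) MeasureTheory.volume u v := fun u hu v hv =>
    ((hPc.mul hf'c).mono (uIcc_subset_Icc hu hv)).intervalIntegrable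
  have key : ∀ n : ℕ, -(C * (P 1 - P 0)) * (1 / ((n : ℝ) + 1))
      ≤ P 1 * f 1 - P 0 * f 0 - ∫ t in (0 : ℝ)..1, P t * f' t := by
    intro n
    have hn : (0 : ℝ) < (n : ℝ) + 1 := by positivity
    have step : ∀ k : ℕ, k ≤ n + 1 → -(C * (1 / ((n : ℝ) + 1))) * (P (k / ((n : ℝ) + 1)) - P 0)
        ≤ P (k / ((n : ℝ) + 1)) * f (k / ((n : ℝ) + 1)) - P 0 * f 0
          - ∫ t in (0 : ℝ)..(k / ((n : ℝ) + 1)), P t * f' t := by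
      intro k
      induction k with
      | zero => simp
      | succ k ih =>
        intro hk
        have hk' : (k : ℝ) + 1 ≤ (n : ℝ) + 1 := by exact_mod_cast hk
        have hx : (k : ℝ) / (n + 1) ∈ Icc (0 : ℝ) 1 :=
          ⟨by positivity, (div_le_one hn).2 (by linarith)⟩
        have hz : ((k + 1 : ℕ) : ℝ) / (n + 1) ∈ Icc (0 : ℝ) 1 :=
          ⟨by positivity, (div_le_one hn).2 (by push_cast; exact hk')⟩
        have hd : ((k + 1 : ℕ) : ℝ) / ((n : ℝ) + 1) - k / (n + 1) = 1 / (n + 1) := by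
          push_cast; ring
        have h1 := ih (by omega)
        set x := (k : ℝ) / ((n : ℝ) + 1)
        set z := ((k + 1 : ℕ) : ℝ) / ((n : ℝ) + 1)
        have hxz : x ≤ z := by
          have : 0 < 1 / ((n : ℝ) + 1) := by positivity
          linarith
        have hss : Icc x z ⊆ Icc 0 1 := Icc_subset_Icc hx.1 hz.2
        have h2 := stieltjes_increment_lower_bound hxz (hPc.mono hss) (hPm.mono hss)
          (fun t ht => (hf t (hss ht)).mono hss) (hf'c.mono hss)
          (fun t ht => hC t (hss ht)) (hf0 x hx)
        rw [hd] at h2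
        rw [← intervalIntegral.integral_add_adjacent_intervals
          (hint 0 (by simp) x hx) (hint x hx z hz)]
        linarith
    have h := step (n + 1) le_rfl
    rw [Nat.cast_add_one, div_self hn.ne'] at h
    linarith
  have hlim := (tendsto_one_div_add_atTop_nhds_zero_nat (𝕜 := ℝ)).const_mul (-(C * (P 1 - P 0)))
  rw [mul_zero] at hlim
  exact le_of_tendsto' hlim key

/-- A function whose derivative within `[0,1]` is the constant `d` is affine on `[0,1]`. -/
theorem eq_affine_of_hasDerivWithinAt_const {f : ℝ → ℝ} {d : ℝ}
    (hf : ∀ t ∈ Icc (0 : ℝ) 1, HasDerivWithinAt f d (Icc 0 1) t) :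
    ∀ t ∈ Icc (0 : ℝ) 1, f t = f 0 + d * t := by
  have hg : ∀ t ∈ Icc (0 : ℝ) 1, HasDerivWithinAt (fun s => f s - d * s) 0 (Icc 0 1) t := by
    intro t ht
    exact ((hf t ht).sub ((hasDerivWithinAt_id t (Icc (0 : ℝ) 1)).const_mul d)).congr_deriv
      (by ring)
  intro t ht
  have := constant_of_derivWithin_zero (fun s hs => (hg s hs).differentiableWithinAt)
    (fun s hs => (hg s (Ico_subset_Icc_self hs)).derivWithin
      (uniqueDiffOn_Icc_zero_one s (Ico_subset_Icc_self hs))) t ht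
  linarith

theorem hasDerivWithinAt_iteratedDerivWithin_Icc {y : ℝ → ℝ} {n m : ℕ}
    (hy : ContDiffOn ℝ n y (Icc 0 1)) (hm : m < n) {t : ℝ} (ht : t ∈ Icc (0 : ℝ) 1) :
    HasDerivWithinAt (iteratedDerivWithin m y (Icc 0 1))
      (iteratedDerivWithin (m + 1) y (Icc 0 1) t) (Icc 0 1) t := by
  rw [iteratedDerivWithin_succ]
  exact (hy.differentiableOn_iteratedDerivWithin (by exact_mod_cast hm)
    uniqueDiffOn_Icc_zero_one t ht).hasDerivWithinAt

/-- The energy identity `λ ∫ y² dP = ∫ y''² + (y''(0)² + y''(1)²) / β`, with `∫ y² dP` written via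
integration by parts. -/
theorem energy_identity {P y y₁ y₂ y₃ : ℝ → ℝ} {α β lam : ℝ} (hβ : 0 < β)
    (hPc : ContinuousOn P (Icc 0 1)) (hP0 : P 0 = 0) (hP1 : P 1 = 1)
    (h0 : ∀ t ∈ Icc (0 : ℝ) 1, HasDerivWithinAt y (y₁ t) (Icc 0 1) t)
    (h1 : ∀ t ∈ Icc (0 : ℝ) 1, HasDerivWithinAt y₁ (y₂ t) (Icc 0 1) t)
    (h2 : ∀ t ∈ Icc (0 : ℝ) 1, HasDerivWithinAt y₂ (y₃ t) (Icc 0 1) t)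
    (hsol : ∀ t ∈ Icc (0 : ℝ) 1, HasDerivWithinAt (fun s => y₃ s - lam * P s * y s)
      (-(lam * P t * y₁ t)) (Icc 0 1) t)
    (b1 : y₂ 0 + α * y 0 - β * y₁ 0 = 0) (b2 : -β * y₃ 0 + α * y₂ 0 = 0)
    (b3 : y₂ 1 + α * y 1 + β * y₁ 1 = 0) (b4 : -β * y₃ 1 - α * y₂ 1 = 0) :
    lam * (y 1 ^ 2 - ∫ t in (0 : ℝ)..1, P t * (2 * y t * y₁ t))
      = (∫ t in (0 : ℝ)..1, y₂ t ^ 2) + (y₂ 0 ^ 2 + y₂ 1 ^ 2) / β := by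
  have c0 : ContinuousOn y (Icc 0 1) := fun t ht => (h0 t ht).continuousWithinAt
  have c1 : ContinuousOn y₁ (Icc 0 1) := fun t ht => (h1 t ht).continuousWithinAt
  have c2 : ContinuousOn y₂ (Icc 0 1) := fun t ht => (h2 t ht).continuousWithinAt
  have i1 : IntervalIntegrable (fun t => y₂ t ^ 2) MeasureTheory.volume 0 1 :=
    (c2.pow 2).intervalIntegrable_of_Icc zero_le_one
  have i1' : IntervalIntegrable (fun t => -(y₂ t ^ 2)) MeasureTheory.volume 0 1 := i1.neg
  have i2 : IntervalIntegrable (fun t => P t * (2 * y t * y₁ t)) MeasureTheory.volume 0 1 :=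
    (hPc.mul ((continuousOn_const.mul c0).mul c1)).intervalIntegrable_of_Icc zero_le_one
  have hD : ∀ t ∈ Icc (0 : ℝ) 1,
      HasDerivWithinAt (fun s => (y₃ s - lam * P s * y s) * y s - y₂ s * y₁ s)
        (-(y₂ t ^ 2) - lam * (P t * (2 * y t * y₁ t))) (Icc 0 1) t := by
    intro t ht
    refine (((hsol t ht).mul (h0 t ht)).sub ((h2 t ht).mul (h1 t ht))).congr_deriv ?_
    ring
  have hftc := intervalIntegral.integral_eq_sub_of_hasDerivAt_of_le zero_le_one
    (fun t ht => (hD t ht).continuousWithinAt)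
    (fun t ht => (hD t (Ioo_subset_Icc_self ht)).hasDerivAt (Icc_mem_nhds ht.1 ht.2))
    (i1'.sub (i2.const_mul lam))
  rw [intervalIntegral.integral_sub i1' (i2.const_mul lam), intervalIntegral.integral_neg,
    intervalIntegral.integral_const_mul, hP0, hP1] at hftc
  have e0 : y₃ 0 = α * y₂ 0 / β := by field_simp; linarith
  have e1 : y₃ 1 = -(α * y₂ 1) / β := by field_simp; linarith
  have d0 : y₁ 0 = (y₂ 0 + α * y 0) / β := by field_simp; linarith
  have d1 : y₁ 1 = -(y₂ 1 + α * y 1) / β := by field_simp; linarith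
  rw [e0, e1, d0, d1] at hftc
  linear_combination hftc

theorem eqOn_zero_of_integral_sq_nonpos {g : ℝ → ℝ} (hg : ContinuousOn g (Icc 0 1))
    (h : ∫ t in (0 : ℝ)..1, g t ^ 2 ≤ 0) : ∀ t ∈ Icc (0 : ℝ) 1, g t = 0 := by
  intro t ht
  by_contra hne
  exact h.not_gt (intervalIntegral.integral_pos zero_lt_one (hg.pow 2)
    (fun s _ => sq_nonneg (g s)) ⟨t, ht, by positivity⟩)

theorem stmt3 (P : ℝ → ℝ) (κ : ℕ) (a : ℝ) (hP : CantorSelfSimilar P κ a)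
    (α β : ℝ) (hα : 0 ≤ α) (hβ : 0 < β)
    (lam : ℝ) (hlam : IsEigenvalue P α β lam) :
    0 ≤ lam ∧ (0 < α → 0 < lam) := by
  obtain ⟨hPc, hPm, hP0, hP1, -⟩ := hP
  obtain ⟨y, ⟨x₀, hx₀, hyx₀⟩, ⟨hy, hsol⟩, b1, b2, b3, b4⟩ := hlam
  have h0 : ∀ t ∈ Icc (0 : ℝ) 1, HasDerivWithinAt y (Y1 y t) (Icc 0 1) t := fun t ht =>
    (hy.differentiableOn (by norm_num) t ht).hasDerivWithinAt
  have h1 : ∀ t ∈ Icc (0 : ℝ) 1, HasDerivWithinAt (Y1 y) (Y2 y t) (Icc 0 1) t := by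
    intro t ht
    have := hasDerivWithinAt_iteratedDerivWithin_Icc (n := 3) (m := 1) hy (by norm_num) ht
    rwa [iteratedDerivWithin_one] at this
  have h2 : ∀ t ∈ Icc (0 : ℝ) 1, HasDerivWithinAt (Y2 y) (Y3 y t) (Icc 0 1) t := fun t ht =>
    hasDerivWithinAt_iteratedDerivWithin_Icc (n := 3) (m := 2) hy (by norm_num) ht
  have c0 : ContinuousOn y (Icc 0 1) := fun t ht => (h0 t ht).continuousWithinAt
  have c1 : ContinuousOn (Y1 y) (Icc 0 1) := fun t ht => (h1 t ht).continuousWithinAt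
  have c2 : ContinuousOn (Y2 y) (Icc 0 1) := fun t ht => (h2 t ht).continuousWithinAt
  have hE := energy_identity hβ hPc hP0 hP1 h0 h1 h2 hsol b1 b2 b3 b4
  have hM := stieltjes_integral_nonneg (f := fun t => y t ^ 2) (f' := fun t => 2 * y t * Y1 y t)
    hPc hPm (fun t ht => ((h0 t ht).pow 2).congr_deriv (by ring))
    ((continuousOn_const.mul c0).mul c1) (fun t _ => sq_nonneg (y t))
  simp only [hP0, hP1, one_mul, zero_mul, sub_zero] at hM
  have hI : 0 ≤ ∫ t in (0 : ℝ)..1, Y2 y t ^ 2 :=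
    intervalIntegral.integral_nonneg zero_le_one fun t _ => sq_nonneg _
  have hB : 0 ≤ (Y2 y 0 ^ 2 + Y2 y 1 ^ 2) / β := by positivity
  -- If `lam ≤ 0`, then `y'' = 0`, and the boundary conditions force `α = 0` and `y` constant.
  have hconst : lam ≤ 0 → α = 0 ∧ ∀ t ∈ Icc (0 : ℝ) 1, y t = y 0 ∧ Y1 y t = 0 := by
    intro hle
    have hz := eqOn_zero_of_integral_sq_nonpos c2
      (by linarith [mul_nonpos_of_nonpos_of_nonneg hle hM])
    have hY1 : ∀ t ∈ Icc (0 : ℝ) 1, Y1 y t = Y1 y 0 := by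
      intro t ht
      simpa using eq_affine_of_hasDerivWithinAt_const
        (fun s hs => (h1 s hs).congr_deriv (hz s hs)) t ht
    have haff := eq_affine_of_hasDerivWithinAt_const
      (fun s hs => (h0 s hs).congr_deriv (hY1 s hs))
    have m0 : (0 : ℝ) ∈ Icc (0 : ℝ) 1 := by simp
    have m1 : (1 : ℝ) ∈ Icc (0 : ℝ) 1 := by simp
    rw [hz 0 m0] at b1
    rw [hz 1 m1, hY1 1 m1, haff 1 m1] at b3
    have hd : Y1 y 0 = 0 := by
      have : (α + 2 * β) * Y1 y 0 = 0 := by linear_combination b3 - b1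
      exact (mul_eq_zero.1 this).resolve_left (by positivity)
    have hy0 : ∀ t ∈ Icc (0 : ℝ) 1, y t = y 0 := fun t ht => by rw [haff t ht, hd]; ring
    refine ⟨?_, fun t ht => ⟨hy0 t ht, (hY1 t ht).trans hd⟩⟩
    rw [hy0 x₀ hx₀] at hyx₀
    have : α * y 0 = 0 := by rw [hd] at b1; linear_combination b1
    exact (mul_eq_zero.1 this).resolve_right hyx₀
  constructor
  · by_contra! hneg
    obtain ⟨-, hc⟩ := hconst hneg.le
    have hzero : ∫ t in (0 : ℝ)..1, P t * (2 * y t * Y1 y t) = 0 := by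
      rw [intervalIntegral.integral_congr (g := fun _ => (0 : ℝ)) fun t ht => ?_]
      · simp
      · rw [uIcc_of_le zero_le_one] at ht
        simp [(hc t ht).2]
    have hy1 : 0 < y 1 ^ 2 := by
      rw [(hc x₀ hx₀).1, ← (hc 1 (by simp)).1] at hyx₀
      positivity
    rw [hzero, sub_zero] at hE
    nlinarith
  · intro hαpos
    by_contra! hle
    exact hαpos.ne' (hconst hle).1
end

section
/- Let λ > 0 be an eigenvalue of the problem (α,β) and let y be a real-valued eigenfunction for λ. Then y(0) ≠ 0, y(1) ≠ 0, and every zero of y in [0,1] is simple, i.e. for every x ∈ [0,1] with y(x) = 0 one has y′(x) ≠ 0. -/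
open Set Filter

theorem monotoneOn_Icc_of_hasDerivWithinAt {f f' : ℝ → ℝ} {a b : ℝ} (ha : 0 ≤ a) (hb : b ≤ 1)
    (hf : ∀ x ∈ Icc (0 : ℝ) 1, HasDerivWithinAt f (f' x) (Icc 0 1) x)
    (hf' : ∀ x ∈ Ioo a b, 0 ≤ f' x) : MonotoneOn f (Icc a b) := by
  have hsub : Icc a b ⊆ Icc (0 : ℝ) 1 := Icc_subset_Icc ha hb
  refine monotoneOn_of_hasDerivWithinAt_nonneg (f' := f') (convex_Icc a b)
    (fun x hx => ((hf x (hsub hx)).continuousWithinAt).mono hsub) ?_ ?_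
  · intro x hx
    exact (hf x (hsub (interior_subset hx))).mono (interior_subset.trans hsub)
  · intro x hx
    rw [interior_Icc] at hx
    exact hf' x hx

/-- A solution of the problem `(α, β)`, with its first three derivatives as separate functions. -/
structure BeamSolution (P : ℝ → ℝ) (α β lam : ℝ) (y y1 y2 y3 : ℝ → ℝ) : Prop where
  deriv0 : ∀ x ∈ Icc (0 : ℝ) 1, HasDerivWithinAt y (y1 x) (Icc 0 1) x
  deriv1 : ∀ x ∈ Icc (0 : ℝ) 1, HasDerivWithinAt y1 (y2 x) (Icc 0 1) x
  deriv2 : ∀ x ∈ Icc (0 : ℝ) 1, HasDerivWithinAt y2 (y3 x) (Icc 0 1) x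
  eqn : ∀ x ∈ Icc (0 : ℝ) 1,
    HasDerivWithinAt (fun t => y3 t - lam * P t * y t) (-(lam * P x * y1 x)) (Icc 0 1) x
  left2 : y2 0 + α * y 0 - β * y1 0 = 0
  left3 : -β * y3 0 + α * y2 0 = 0
  right2 : y2 1 + α * y 1 + β * y1 1 = 0
  right3 : -β * y3 1 - α * y2 1 = 0

namespace BeamSolution

variable {P : ℝ → ℝ} {α β lam : ℝ} {y y1 y2 y3 : ℝ → ℝ}

theorem neg (h : BeamSolution P α β lam y y1 y2 y3) :
    BeamSolution P α β lam (fun x => -y x) (fun x => -y1 x) (fun x => -y2 x)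
      (fun x => -y3 x) where
  deriv0 x hx := (h.deriv0 x hx).neg
  deriv1 x hx := (h.deriv1 x hx).neg
  deriv2 x hx := (h.deriv2 x hx).neg
  eqn x hx := ((h.eqn x hx).fun_neg.congr_deriv (by ring)).congr (fun t _ => by ring) (by ring)
  left2 := by linarith [h.left2]
  left3 := by linarith [h.left3]
  right2 := by linarith [h.right2]
  right3 := by linarith [h.right3]

theorem hasDerivWithinAt_reflect {f : ℝ → ℝ} {f' x : ℝ}
    (hf : HasDerivWithinAt f f' (Icc 0 1) (1 - x)) :
    HasDerivWithinAt (fun t => f (1 - t)) (-f') (Icc 0 1) x := by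
  have h1 : HasDerivWithinAt (fun t : ℝ => 1 - t) (-1) (Icc 0 1) x :=
    ((hasDerivAt_id x).const_sub 1).hasDerivWithinAt
  have h2 := HasDerivWithinAt.comp x hf h1 fun t ht => ⟨by linarith [ht.2], by linarith [ht.1]⟩
  simpa [Function.comp_def] using h2

theorem reflect (h : BeamSolution P α β lam y y1 y2 y3) :
    BeamSolution (fun x => 1 - P (1 - x)) α β lam (fun x => y (1 - x)) (fun x => -y1 (1 - x))
      (fun x => y2 (1 - x)) (fun x => -y3 (1 - x)) := by
  have hmem : ∀ x ∈ Icc (0 : ℝ) 1, 1 - x ∈ Icc (0 : ℝ) 1 :=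
    fun x hx => ⟨by linarith [hx.2], by linarith [hx.1]⟩
  refine ⟨fun x hx => hasDerivWithinAt_reflect (h.deriv0 _ (hmem x hx)), fun x hx => ?_,
    fun x hx => hasDerivWithinAt_reflect (h.deriv2 _ (hmem x hx)), fun x hx => ?_, ?_, ?_, ?_, ?_⟩
  · simpa using (hasDerivWithinAt_reflect (h.deriv1 _ (hmem x hx))).fun_neg
  · have h1 := (hasDerivWithinAt_reflect (h.eqn _ (hmem x hx))).fun_neg
    have h2 := (hasDerivWithinAt_reflect (h.deriv0 _ (hmem x hx))).const_mul lam
    exact ((h1.fun_sub h2).congr_deriv (by ring)).congr (fun t _ => by ring) (by ring)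
  · simp only [sub_zero]; linarith [h.right2]
  · simp only [sub_zero]; linarith [h.right3]
  · simp only [sub_self]; linarith [h.left2]
  · simp only [sub_self]; linarith [h.left3]

/-- If `y + ε exp (K ·)` is nondecreasing on `[a, s]` and nonnegative at `a`, then `y'''` does not
drop by more than `ε λ exp (K s)` over `[a, s]`. -/
theorem third_deriv_lower_bound (h : BeamSolution P α β lam y y1 y2 y3)
    (hP : MonotoneOn P (Icc 0 1)) (hP01 : ∀ x ∈ Icc (0 : ℝ) 1, P x ∈ Icc (0 : ℝ) 1)
    (hlam : 0 ≤ lam) {a s ε K : ℝ} (ha : 0 ≤ a) (has : a ≤ s) (hs : s ≤ 1) (hε : 0 ≤ ε)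
    (hK : 0 ≤ K) (hya : 0 ≤ y a)
    (hz : ∀ t ∈ Ioo a s, 0 ≤ y1 t + ε * (K * Real.exp (K * t))) :
    y3 a - ε * lam * Real.exp (K * s) ≤ y3 s := by
  have ha' : a ∈ Icc (0 : ℝ) 1 := ⟨ha, has.trans hs⟩
  have hs' : s ∈ Icc (0 : ℝ) 1 := ⟨ha.trans has, hs⟩
  have hexp : ∀ x : ℝ, HasDerivWithinAt (fun t => Real.exp (K * t)) (K * Real.exp (K * x))
      (Icc 0 1) x := fun x => by
    have := (((hasDerivAt_id x).const_mul K).exp).hasDerivWithinAt (s := Icc 0 1)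
    simpa [mul_comm] using this
  have hmono := monotoneOn_Icc_of_hasDerivWithinAt ha hs
    (f := fun t => (y3 t - lam * P t * y t)
      + (lam * P s * (y t + ε * Real.exp (K * t)) - lam * ε * P a * Real.exp (K * t)))
    (fun x hx => (h.eqn x hx).fun_add
      ((((h.deriv0 x hx).fun_add ((hexp x).const_mul ε)).const_mul (lam * P s)).fun_sub
        ((hexp x).const_mul (lam * ε * P a)))) (by
      intro x hx
      have hx' : x ∈ Icc (0 : ℝ) 1 := ⟨ha.trans hx.1.le, hx.2.le.trans hs⟩
      have h1 : 0 ≤ lam * ((P s - P x) * (y1 x + ε * (K * Real.exp (K * x)))) :=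
        mul_nonneg hlam (mul_nonneg (sub_nonneg.2 (hP hx' hs' hx.2.le)) (hz x hx))
      have h2 : 0 ≤ lam * ((P x - P a) * (ε * (K * Real.exp (K * x)))) :=
        mul_nonneg hlam (mul_nonneg (sub_nonneg.2 (hP ha' hx' hx.1.le)) (by positivity))
      linarith)
  have hle := hmono (left_mem_Icc.2 has) (right_mem_Icc.2 has) has
  simp only at hle
  have hPas : 0 ≤ P s - P a := sub_nonneg.2 (hP ha' hs' has)
  have h3 : 0 ≤ lam * ((P s - P a) * (y a + ε * Real.exp (K * a))) :=
    mul_nonneg hlam (mul_nonneg hPas (by positivity))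
  have h4 : 0 ≤ lam * ε * Real.exp (K * s) * (1 - (P s - P a)) :=
    mul_nonneg (by positivity) (by linarith [(hP01 s hs').2, (hP01 a ha').1])
  linarith

theorem first_deriv_nonneg (h : BeamSolution P α β lam y y1 y2 y3)
    (hP : MonotoneOn P (Icc 0 1)) (hP01 : ∀ x ∈ Icc (0 : ℝ) 1, P x ∈ Icc (0 : ℝ) 1)
    (hlam : 0 ≤ lam) {a : ℝ} (ha : 0 ≤ a) (h0 : 0 ≤ y a) (h1 : 0 ≤ y1 a) (h2 : 0 ≤ y2 a)
    (h3 : 0 ≤ y3 a) {x : ℝ} (hx : x ∈ Icc a 1) : 0 ≤ y1 x := by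
  set K : ℝ := 1 + lam with hKdef
  have hK1 : 1 ≤ K := by linarith
  have hK3 : lam ≤ K * (K * K) := by nlinarith [mul_nonneg hlam hlam]
  have hexp : ∀ x : ℝ, HasDerivWithinAt (fun t => Real.exp (K * t)) (K * Real.exp (K * x))
      (Icc 0 1) x := fun x => by
    have := (((hasDerivAt_id x).const_mul K).exp).hasDerivWithinAt (s := Icc 0 1)
    simpa [mul_comm] using this
  have key : ∀ ε > 0, ∀ t ∈ Icc a 1, 0 < y1 t + ε * (K * Real.exp (K * t)) := by
    intro ε hε
    by_contra! hcon
    have hcont : ContinuousOn (fun t => y1 t + ε * (K * Real.exp (K * t))) (Icc a 1) :=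
      fun t ht => (((h.deriv1 t ⟨ha.trans ht.1, ht.2⟩).fun_add
        (((hexp t).const_mul K).const_mul ε)).continuousWithinAt).mono (Icc_subset_Icc_left ha)
    have hclosed : IsClosed (Icc a 1 ∩ (fun t => y1 t + ε * (K * Real.exp (K * t))) ⁻¹' Iic 0) :=
      hcont.preimage_isClosed_of_isClosed isClosed_Icc isClosed_Iic
    obtain ⟨t, ⟨ht, htle⟩, hmin⟩ := (isCompact_Icc.of_isClosed_subset hclosed
      inter_subset_left).exists_isLeast (by obtain ⟨t, ht, hle⟩ := hcon; exact ⟨t, ht, hle⟩)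
    have hpos : ∀ s ∈ Ioo a t, 0 ≤ y1 s + ε * (K * Real.exp (K * s)) := by
      intro s hs
      by_contra! hneg
      exact absurd (hmin ⟨⟨hs.1.le, hs.2.le.trans ht.2⟩, hneg.le⟩) (not_le.2 hs.2)
    have hz3 : ∀ s ∈ Ioo a t, 0 ≤ y3 s + ε * (K * (K * (K * Real.exp (K * s)))) := by
      intro s hs
      have hb := h.third_deriv_lower_bound hP hP01 hlam ha hs.1.le (hs.2.le.trans ht.2) hε.le
        (by linarith) h0 fun r hr => hpos r ⟨hr.1, hr.2.trans hs.2⟩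
      have : 0 ≤ ε * Real.exp (K * s) * (K * (K * K) - lam) :=
        mul_nonneg (by positivity) (sub_nonneg.2 hK3)
      linarith
    have hz2 := monotoneOn_Icc_of_hasDerivWithinAt ha ht.2
      (fun s hs => (h.deriv2 s hs).fun_add ((((hexp s).const_mul K).const_mul K).const_mul ε)) hz3
    have hz1 := monotoneOn_Icc_of_hasDerivWithinAt ha ht.2
      (fun s hs => (h.deriv1 s hs).fun_add (((hexp s).const_mul K).const_mul ε)) (by
        intro s hs
        refine le_trans ?_ (hz2 (left_mem_Icc.2 ht.1) (Ioo_subset_Icc_self hs) hs.1.le)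
        positivity)
    have := hz1 (left_mem_Icc.2 ht.1) (right_mem_Icc.2 ht.1) ht.1
    simp only [mem_preimage, mem_Iic] at this htle
    have : 0 < ε * (K * Real.exp (K * a)) := by positivity
    linarith
  refine le_of_forall_pos_le_add fun δ hδ => ?_
  have hC : 0 < K * Real.exp (K * x) := by positivity
  have := key (δ / (K * Real.exp (K * x))) (by positivity) x hx
  rw [div_mul_cancel₀ _ hC.ne'] at this
  exact this.le

/-- Nonnegative Cauchy data at a point stay nonnegative, and `y'`, `y''`, `y'''` do not fall below
their initial values. -/
theorem forward_lower_bounds (h : BeamSolution P α β lam y y1 y2 y3)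
    (hP : MonotoneOn P (Icc 0 1)) (hP01 : ∀ x ∈ Icc (0 : ℝ) 1, P x ∈ Icc (0 : ℝ) 1)
    (hlam : 0 ≤ lam) {a : ℝ} (ha : 0 ≤ a) (h0 : 0 ≤ y a) (h1 : 0 ≤ y1 a) (h2 : 0 ≤ y2 a)
    (h3 : 0 ≤ y3 a) {x : ℝ} (hx : x ∈ Icc a 1) :
    y a ≤ y x ∧ y1 a ≤ y1 x ∧ y2 a ≤ y2 x ∧ y3 a ≤ y3 x := by
  have hy1 : ∀ s ∈ Icc a 1, 0 ≤ y1 s := fun s hs =>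
    h.first_deriv_nonneg hP hP01 hlam ha h0 h1 h2 h3 hs
  have hy3 : ∀ s ∈ Icc a 1, y3 a ≤ y3 s := fun s hs => by
    simpa using h.third_deriv_lower_bound (ε := 0) (K := 0) hP hP01 hlam ha hs.1 hs.2 le_rfl
      le_rfl h0 fun t ht => by simpa using hy1 t ⟨ht.1.le, ht.2.le.trans hs.2⟩
  have hl : a ∈ Icc a 1 := left_mem_Icc.2 (hx.1.trans hx.2)
  have hy2 : ∀ s ∈ Icc a 1, y2 a ≤ y2 s := fun s hs =>
    monotoneOn_Icc_of_hasDerivWithinAt ha le_rfl h.deriv2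
      (fun t ht => h3.trans (hy3 t (Ioo_subset_Icc_self ht))) hl hs hs.1
  refine ⟨?_, ?_, hy2 x hx, hy3 x hx⟩
  · exact monotoneOn_Icc_of_hasDerivWithinAt ha le_rfl h.deriv0
      (fun t ht => hy1 t (Ioo_subset_Icc_self ht)) hl hx hx.1
  · exact monotoneOn_Icc_of_hasDerivWithinAt ha le_rfl h.deriv1
      (fun t ht => h2.trans (hy2 t (Ioo_subset_Icc_self ht))) hl hx hx.1

theorem eq_zero_right (h : BeamSolution P α β lam y y1 y2 y3)
    (hP : MonotoneOn P (Icc 0 1)) (hP01 : ∀ x ∈ Icc (0 : ℝ) 1, P x ∈ Icc (0 : ℝ) 1)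
    (hlam : 0 ≤ lam) {a : ℝ} (ha : 0 ≤ a) (h0 : y a = 0) (h1 : y1 a = 0) (h2 : y2 a = 0)
    (h3 : y3 a = 0) {x : ℝ} (hx : x ∈ Icc a 1) : y x = 0 := by
  have hp := (h.forward_lower_bounds hP hP01 hlam ha h0.ge h1.ge h2.ge h3.ge hx).1
  have hn := (h.neg.forward_lower_bounds hP hP01 hlam ha (by simp [h0]) (by simp [h1])
    (by simp [h2]) (by simp [h3]) hx).1
  linarith

theorem monotoneOn_reflect (hP : MonotoneOn P (Icc 0 1)) :
    MonotoneOn (fun x => 1 - P (1 - x)) (Icc 0 1) := fun x hx z hz hxz =>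
  sub_le_sub_left (hP ⟨by linarith [hz.2], by linarith [hz.1]⟩
    ⟨by linarith [hx.2], by linarith [hx.1]⟩ (by linarith)) 1

theorem reflect_mem (hP01 : ∀ x ∈ Icc (0 : ℝ) 1, P x ∈ Icc (0 : ℝ) 1) :
    ∀ x ∈ Icc (0 : ℝ) 1, 1 - P (1 - x) ∈ Icc (0 : ℝ) 1 := fun x hx => by
  have := hP01 (1 - x) ⟨by linarith [hx.2], by linarith [hx.1]⟩
  exact ⟨by linarith [this.2], by linarith [this.1]⟩

theorem eq_zero_of_cauchy_zero (h : BeamSolution P α β lam y y1 y2 y3)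
    (hP : MonotoneOn P (Icc 0 1)) (hP01 : ∀ x ∈ Icc (0 : ℝ) 1, P x ∈ Icc (0 : ℝ) 1)
    (hlam : 0 ≤ lam) {a : ℝ} (ha : a ∈ Icc (0 : ℝ) 1) (h0 : y a = 0) (h1 : y1 a = 0)
    (h2 : y2 a = 0) (h3 : y3 a = 0) {x : ℝ} (hx : x ∈ Icc (0 : ℝ) 1) : y x = 0 := by
  rcases le_total a x with hax | hxa
  · exact h.eq_zero_right hP hP01 hlam ha.1 h0 h1 h2 h3 ⟨hax, hx.2⟩
  · have := h.reflect.eq_zero_right (monotoneOn_reflect hP) (reflect_mem hP01) hlam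
      (a := 1 - a) (x := 1 - x) (by linarith [ha.2]) (by simp [h0]) (by simp [h1])
      (by simp [h2]) (by simp [h3]) ⟨by linarith, by linarith [hx.1]⟩
    simpa using this

/-- A solution that vanishes at a point where its first three derivatives are nonnegative is
identically zero. -/
theorem eq_zero_of_nonneg (h : BeamSolution P α β lam y y1 y2 y3)
    (hP : MonotoneOn P (Icc 0 1)) (hP01 : ∀ x ∈ Icc (0 : ℝ) 1, P x ∈ Icc (0 : ℝ) 1)
    (hlam : 0 ≤ lam) (hα : 0 ≤ α) (hβ : 0 < β) {a : ℝ} (ha : a ∈ Icc (0 : ℝ) 1)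
    (h0 : y a = 0) (h1 : 0 ≤ y1 a) (h2 : 0 ≤ y2 a) (h3 : 0 ≤ y3 a) {x : ℝ}
    (hx : x ∈ Icc (0 : ℝ) 1) : y x = 0 := by
  obtain ⟨b0, b1, b2, b3⟩ := h.forward_lower_bounds hP hP01 hlam ha.1 h0.ge h1 h2 h3
    (right_mem_Icc.2 ha.2)
  have hr2 := h.right2
  have hr3 := h.right3
  have e0 : 0 ≤ α * y 1 := mul_nonneg hα (by linarith)
  have e1 : 0 ≤ β * y1 1 := mul_nonneg hβ.le (by linarith)
  have z2 : y2 1 = 0 := by linarith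
  have z1 : y1 1 = 0 := by
    have : β * y1 1 = 0 := by linarith
    exact (mul_eq_zero.1 this).resolve_left hβ.ne'
  have z3 : y3 1 = 0 := by
    have : β * y3 1 = 0 := by rw [z2] at hr3; linarith
    exact (mul_eq_zero.1 this).resolve_left hβ.ne'
  exact h.eq_zero_of_cauchy_zero hP hP01 hlam ha h0 (by linarith) (by linarith) (by linarith) hx

theorem eq_zero_of_left_eq_zero (h : BeamSolution P α β lam y y1 y2 y3)
    (hP : MonotoneOn P (Icc 0 1)) (hP01 : ∀ x ∈ Icc (0 : ℝ) 1, P x ∈ Icc (0 : ℝ) 1)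
    (hlam : 0 ≤ lam) (hα : 0 ≤ α) (hβ : 0 < β) (h0 : y 0 = 0) {x : ℝ}
    (hx : x ∈ Icc (0 : ℝ) 1) : y x = 0 := by
  wlog h1 : 0 ≤ y1 0 generalizing y y1 y2 y3
  · simpa using this h.neg (by simp [h0]) (by linarith)
  have h2 : y2 0 = β * y1 0 := by have := h.left2; rw [h0] at this; linarith
  have h3 : y3 0 = α * y1 0 := by
    refine mul_left_cancel₀ hβ.ne' ?_
    have := h.left3
    rw [h2] at this
    linarith
  exact h.eq_zero_of_nonneg hP hP01 hlam hα hβ (left_mem_Icc.2 zero_le_one) h0 h1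
    (h2 ▸ by positivity) (h3 ▸ by positivity) hx

theorem eq_zero_of_right_eq_zero (h : BeamSolution P α β lam y y1 y2 y3)
    (hP : MonotoneOn P (Icc 0 1)) (hP01 : ∀ x ∈ Icc (0 : ℝ) 1, P x ∈ Icc (0 : ℝ) 1)
    (hlam : 0 ≤ lam) (hα : 0 ≤ α) (hβ : 0 < β) (h0 : y 1 = 0) {x : ℝ}
    (hx : x ∈ Icc (0 : ℝ) 1) : y x = 0 := by
  simpa using h.reflect.eq_zero_of_left_eq_zero (monotoneOn_reflect hP) (reflect_mem hP01) hlam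
    hα hβ (by simpa using h0) (x := 1 - x) ⟨by linarith [hx.2], by linarith [hx.1]⟩

theorem eq_zero_of_double_zero (h : BeamSolution P α β lam y y1 y2 y3)
    (hP : MonotoneOn P (Icc 0 1)) (hP01 : ∀ x ∈ Icc (0 : ℝ) 1, P x ∈ Icc (0 : ℝ) 1)
    (hlam : 0 ≤ lam) (hα : 0 ≤ α) (hβ : 0 < β) {a : ℝ} (ha : a ∈ Icc (0 : ℝ) 1)
    (h0 : y a = 0) (h1 : y1 a = 0) {x : ℝ} (hx : x ∈ Icc (0 : ℝ) 1) : y x = 0 := by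
  wlog h2 : 0 ≤ y2 a generalizing y y1 y2 y3
  · simpa using this h.neg (by simp [h0]) (by simp [h1]) (by linarith)
  rcases le_total 0 (y3 a) with h3 | h3
  · exact h.eq_zero_of_nonneg hP hP01 hlam hα hβ ha h0 h1.ge h2 h3 hx
  · have := h.reflect.eq_zero_of_nonneg (monotoneOn_reflect hP) (reflect_mem hP01) hlam hα hβ
      (a := 1 - a) (x := 1 - x) ⟨by linarith [ha.2], by linarith [ha.1]⟩ (by simp [h0])
      (by simp [h1]) (by simpa using h2) (by simpa using h3)
      ⟨by linarith [hx.2], by linarith [hx.1]⟩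
    simpa using this

end BeamSolution

theorem Eigenfunction.beamSolution {P : ℝ → ℝ} {α β lam : ℝ} {y : ℝ → ℝ}
    (hy : Eigenfunction P α β lam y) : BeamSolution P α β lam y (Y1 y) (Y2 y) (Y3 y) := by
  obtain ⟨-, ⟨hC, heq⟩, b1, b2, b3, b4⟩ := hy
  have hd : ∀ n : ℕ, n < 3 → ∀ x ∈ Icc (0 : ℝ) 1, HasDerivWithinAt
      (iteratedDerivWithin n y (Icc 0 1)) (iteratedDerivWithin (n + 1) y (Icc 0 1) x)
      (Icc 0 1) x := by
    intro n hn x hx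
    rw [iteratedDerivWithin_succ]
    exact (hC.differentiableOn_iteratedDerivWithin (by exact_mod_cast hn)
      (uniqueDiffOn_Icc zero_lt_one) x hx).hasDerivWithinAt
  have hY1 : Y1 y = iteratedDerivWithin 1 y (Icc 0 1) := iteratedDerivWithin_one.symm
  refine ⟨fun x hx => ?_, fun x hx => ?_, hd 2 (by norm_num), heq, b1, b2, b3, b4⟩
  · rw [hY1]
    simpa using hd 0 (by norm_num) x hx
  · rw [hY1]
    exact hd 1 (by norm_num) x hx

theorem stmt4 (P : ℝ → ℝ) (κ : ℕ) (a : ℝ) (hP : CantorSelfSimilar P κ a)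
    (α β : ℝ) (hα : 0 ≤ α) (hβ : 0 < β)
    (lam : ℝ) (hlam : 0 < lam) (y : ℝ → ℝ) (hy : Eigenfunction P α β lam y) :
    y 0 ≠ 0 ∧ y 1 ≠ 0 ∧ ∀ x ∈ Set.Icc (0:ℝ) 1, y x = 0 → Y1 y x ≠ 0 := by
  obtain ⟨-, hmono, hP0, hP1, -⟩ := hP
  have hP01 : ∀ x ∈ Icc (0 : ℝ) 1, P x ∈ Icc (0 : ℝ) 1 := fun x hx =>
    ⟨hP0 ▸ hmono (left_mem_Icc.2 zero_le_one) hx hx.1,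
      hP1 ▸ hmono hx (right_mem_Icc.2 zero_le_one) hx.2⟩
  obtain ⟨x, hx, hyx⟩ := hy.1
  have h := hy.beamSolution
  exact ⟨fun h0 => hyx (h.eq_zero_of_left_eq_zero hmono hP01 hlam.le hα hβ h0 hx),
    fun h0 => hyx (h.eq_zero_of_right_eq_zero hmono hP01 hlam.le hα hβ h0 hx),
    fun t ht h0 h1 => hyx (h.eq_zero_of_double_zero hmono hP01 hlam.le hα hβ ht h0 h1 hx)⟩
end

section
/- Every positive eigenvalue of the problem (α,β) is simple: if λ > 0 and y and z are both real-valued eigenfunctions of the problem (α,β) with eigenvalue λ, then y and z are linearly dependent, i.e. there exists a real constant c with z(x) = c·y(x) for all x ∈ [0,1] or y(x) = c·z(x) for all x ∈ [0,1]. -/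
open Set Filter

/-- The equation of `SolutionOn` as a first order system, with `u₁`, `u₂`, `u₃` in the roles of the
first three derivatives of `u₀`. -/
structure IsSystemSolution (P : ℝ → ℝ) (lam : ℝ) (u₀ u₁ u₂ u₃ : ℝ → ℝ) : Prop where
  deriv_zero : ∀ x ∈ Icc (0:ℝ) 1, HasDerivWithinAt u₀ (u₁ x) (Icc 0 1) x
  deriv_one : ∀ x ∈ Icc (0:ℝ) 1, HasDerivWithinAt u₁ (u₂ x) (Icc 0 1) x
  deriv_two : ∀ x ∈ Icc (0:ℝ) 1, HasDerivWithinAt u₂ (u₃ x) (Icc 0 1) x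
  deriv_quasi : ∀ x ∈ Icc (0:ℝ) 1,
    HasDerivWithinAt (fun t => u₃ t - lam * P t * u₀ t) (-(lam * P x * u₁ x)) (Icc 0 1) x

theorem SolutionOn.isSystemSolution {P : ℝ → ℝ} {lam : ℝ} {y : ℝ → ℝ}
    (h : SolutionOn P lam y) : IsSystemSolution P lam y (Y1 y) (Y2 y) (Y3 y) := by
  have hu : UniqueDiffOn ℝ (Icc (0:ℝ) 1) := uniqueDiffOn_Icc one_pos
  have hd (m : ℕ) (hm : m < 3) (x : ℝ) (hx : x ∈ Icc (0:ℝ) 1) :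
      HasDerivWithinAt (iteratedDerivWithin m y (Icc 0 1))
        (iteratedDerivWithin (m + 1) y (Icc 0 1) x) (Icc 0 1) x := by
    rw [iteratedDerivWithin_succ]
    exact (h.1.differentiableOn_iteratedDerivWithin (mod_cast hm) hu x hx).hasDerivWithinAt
  refine ⟨fun x hx => ?_, fun x hx => ?_, fun x hx => hd 2 (by norm_num) x hx, h.2⟩
  · simpa only [Y1, iteratedDerivWithin_zero, zero_add, iteratedDerivWithin_one] using
      hd 0 (by norm_num) x hx
  · simpa only [Y1, Y2, Nat.reduceAdd, iteratedDerivWithin_one] using hd 1 (by norm_num) x hx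

/-- A function with nonnegative derivative on a subinterval of `[0,1]` increases along it. -/
theorem le_of_hasDerivWithinAt_Icc_nonneg {f f' : ℝ → ℝ} {a b : ℝ}
    (hf : ∀ x ∈ Icc (0:ℝ) 1, HasDerivWithinAt f (f' x) (Icc 0 1) x)
    (ha : 0 ≤ a) (hab : a ≤ b) (hb : b ≤ 1) (hf' : ∀ x ∈ Icc a b, 0 ≤ f' x) : f a ≤ f b := by
  have hsub : Icc a b ⊆ Icc (0:ℝ) 1 := Icc_subset_Icc ha hb
  have hmono : MonotoneOn f (Icc a b) :=
    monotoneOn_of_hasDerivWithinAt_nonneg (f' := f') (convex_Icc a b)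
      (fun x hx => ((hf x (hsub hx)).mono hsub).continuousWithinAt)
      (fun x hx => (hf x (hsub (interior_subset hx))).mono (interior_subset.trans hsub))
      (fun x hx => hf' x (interior_subset hx))
  exact hmono (left_mem_Icc.2 hab) (right_mem_Icc.2 hab) hab

namespace IsSystemSolution

variable {P : ℝ → ℝ} {lam : ℝ} {u₀ u₁ u₂ u₃ v₀ v₁ v₂ v₃ : ℝ → ℝ}

theorem sub_const_mul (hu : IsSystemSolution P lam u₀ u₁ u₂ u₃)
    (hv : IsSystemSolution P lam v₀ v₁ v₂ v₃) (c : ℝ) :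
    IsSystemSolution P lam (fun t => u₀ t - c * v₀ t) (fun t => u₁ t - c * v₁ t)
      (fun t => u₂ t - c * v₂ t) (fun t => u₃ t - c * v₃ t) where
  deriv_zero x hx := (hu.deriv_zero x hx).sub ((hv.deriv_zero x hx).const_mul c)
  deriv_one x hx := (hu.deriv_one x hx).sub ((hv.deriv_one x hx).const_mul c)
  deriv_two x hx := (hu.deriv_two x hx).sub ((hv.deriv_two x hx).const_mul c)
  deriv_quasi x hx := by
    have h := (hu.deriv_quasi x hx).sub ((hv.deriv_quasi x hx).const_mul c)
    refine (h.congr_deriv (by ring)).congr_of_mem (fun t _ => ?_) hx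
    simp only [Pi.sub_apply]
    ring

theorem neg (hu : IsSystemSolution P lam u₀ u₁ u₂ u₃) :
    IsSystemSolution P lam (fun t => -u₀ t) (fun t => -u₁ t) (fun t => -u₂ t)
      (fun t => -u₃ t) where
  deriv_zero x hx := (hu.deriv_zero x hx).neg
  deriv_one x hx := (hu.deriv_one x hx).neg
  deriv_two x hx := (hu.deriv_two x hx).neg
  deriv_quasi x hx := by
    refine ((hu.deriv_quasi x hx).neg.congr_deriv (by ring)).congr_of_mem (fun t _ => ?_) hx
    simp only [Pi.neg_apply]
    ring

/-- A solution with zero Cauchy data at `0` vanishes on `[0,1]`. -/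
theorem eq_zero_of_initial (hu : IsSystemSolution P lam u₀ u₁ u₂ u₃) (hlam : 0 ≤ lam)
    (hP : ∀ x ∈ Icc (0:ℝ) 1, P x ∈ Icc (0:ℝ) 1)
    (h₀ : u₀ 0 = 0) (h₁ : u₁ 0 = 0) (h₂ : u₂ 0 = 0) (h₃ : u₃ 0 = 0) :
    ∀ x ∈ Icc (0:ℝ) 1, u₀ x = 0 := by
  set q : ℝ → ℝ := fun t => u₃ t - lam * P t * u₀ t with hq
  set F : ℝ → ℝ × ℝ × ℝ × ℝ := fun t => (u₀ t, u₁ t, u₂ t, q t) with hF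
  have hFd : ∀ x ∈ Icc (0:ℝ) 1,
      HasDerivWithinAt F (u₁ x, u₂ x, u₃ x, -(lam * P x * u₁ x)) (Icc 0 1) x := fun x hx =>
    (hu.deriv_zero x hx).prodMk ((hu.deriv_one x hx).prodMk
      ((hu.deriv_two x hx).prodMk (hu.deriv_quasi x hx)))
  have hbound : ∀ x ∈ Ico (0:ℝ) 1,
      ‖(u₁ x, u₂ x, u₃ x, -(lam * P x * u₁ x))‖ ≤ (1 + lam) * ‖F x‖ + 0 := by
    intro x hx
    obtain ⟨hP0, hP1⟩ := hP x (Ico_subset_Icc_self hx)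
    have hn : 0 ≤ ‖F x‖ := norm_nonneg _
    have n₀ : |u₀ x| ≤ ‖F x‖ := norm_fst_le (F x)
    have n₁ : |u₁ x| ≤ ‖F x‖ := (norm_fst_le (F x).2).trans (norm_snd_le (F x))
    have n₂ : |u₂ x| ≤ ‖F x‖ :=
      (norm_fst_le (F x).2.2).trans ((norm_snd_le (F x).2).trans (norm_snd_le (F x)))
    have n₃ : |q x| ≤ ‖F x‖ :=
      (norm_snd_le (F x).2.2).trans ((norm_snd_le (F x).2).trans (norm_snd_le (F x)))
    have hle : lam * P x ≤ lam := mul_le_of_le_one_right hlam hP1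
    have hnn : 0 ≤ lam * P x := mul_nonneg hlam hP0
    have hmul (w : ℝ) (hw : |w| ≤ ‖F x‖) : |lam * P x * w| ≤ lam * ‖F x‖ := by
      rw [abs_mul, abs_of_nonneg hnn]
      exact mul_le_mul hle hw (abs_nonneg w) hlam
    have e₃ : u₃ x = q x + lam * P x * u₀ x := by simp only [hq]; ring
    have hl : 0 ≤ lam * ‖F x‖ := mul_nonneg hlam hn
    have b₃ : |u₃ x| ≤ ‖F x‖ + lam * ‖F x‖ := by
      rw [e₃]
      exact (abs_add_le _ _).trans (add_le_add n₃ (hmul _ n₀))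
    simp only [norm_prod_le_iff, Real.norm_eq_abs, abs_neg]
    refine ⟨by linarith, by linarith, by linarith, by linarith [hmul _ n₁]⟩
  have hG := norm_le_gronwallBound_of_norm_deriv_right_le (δ := 0) (f := F)
    (fun x hx => (hFd x hx).continuousWithinAt)
    (fun x hx => (hFd x (Ico_subset_Icc_self hx)).mono_of_mem_nhdsWithin
      (Icc_mem_nhdsGE_of_mem hx))
    (by simp [hF, hq, h₀, h₁, h₂, h₃]) hbound
  intro x hx
  have h := hG x hx
  rw [gronwallBound_ε0_δ0] at h
  exact abs_nonpos_iff.1 ((norm_fst_le (F x)).trans h)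

/-- A lower bound for the third derivative at `t`, when the first derivative is nonnegative up to
`s ≤ t` and at least `-M` on `[s,t]`. -/
theorem third_deriv_lower_bound (hu : IsSystemSolution P lam u₀ u₁ u₂ u₃) (hlam : 0 ≤ lam)
    (hmono : MonotoneOn P (Icc 0 1)) (hP0 : P 0 = 0) (h₃ : u₃ 0 = 0) {M s t : ℝ} (hM : 0 ≤ M)
    (hs : 0 ≤ s) (hst : s ≤ t) (ht : t ≤ 1) (hpos : ∀ x ∈ Icc 0 s, 0 ≤ u₁ x)
    (hlow : ∀ x ∈ Icc s t, -M ≤ u₁ x) :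
    lam * P t * (u₀ 0 - M * (t - s)) ≤ u₃ t := by
  have htm : t ∈ Icc (0:ℝ) 1 := ⟨hs.trans hst, ht⟩
  have hPle {r : ℝ} (hr : 0 ≤ r) (hrt : r ≤ t) : 0 ≤ P r ∧ P r ≤ P t := by
    have hrm : r ∈ Icc (0:ℝ) 1 := ⟨hr, hrt.trans ht⟩
    exact ⟨hP0 ▸ hmono (left_mem_Icc.2 zero_le_one) hrm hr, hmono hrm htm hrt⟩
  have hφ (C : ℝ) : ∀ x ∈ Icc (0:ℝ) 1, HasDerivWithinAt
      (fun r => (u₃ r - lam * P r * u₀ r) + (lam * P t * u₀ r + C * r))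
      (-(lam * P x * u₁ x) + (lam * P t * u₁ x + C * 1)) (Icc 0 1) x := fun x hx =>
    (hu.deriv_quasi x hx).add (((hu.deriv_zero x hx).const_mul _).add
      ((hasDerivWithinAt_id x _).const_mul C))
  have hleft := le_of_hasDerivWithinAt_Icc_nonneg (hφ 0) le_rfl hs (hst.trans ht) fun x hx => by
    have h := hPle hx.1 (hx.2.trans hst)
    nlinarith [mul_nonneg (mul_nonneg hlam (sub_nonneg.2 h.2)) (hpos x hx)]
  have hright := le_of_hasDerivWithinAt_Icc_nonneg (hφ (lam * P t * M)) hs hst ht fun x hx => by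
    have h := hPle (hs.trans hx.1) hx.2
    have hx1 := hlow x hx
    nlinarith [mul_nonneg (mul_nonneg hlam (sub_nonneg.2 h.2)) (by linarith : 0 ≤ u₁ x + M),
      mul_nonneg (mul_nonneg hlam h.1) hM]
  simp only [hP0, h₃] at hleft hright
  nlinarith

/-- A solution that starts from a positive value with nonnegative slope and vanishing second and
third derivatives keeps a nonnegative slope. -/
theorem first_deriv_nonneg (hu : IsSystemSolution P lam u₀ u₁ u₂ u₃) (hlam : 0 ≤ lam)
    (hmono : MonotoneOn P (Icc 0 1)) (hP0 : P 0 = 0) (h₀ : 0 < u₀ 0) (h₁ : 0 ≤ u₁ 0)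
    (h₂ : u₂ 0 = 0) (h₃ : u₃ 0 = 0) : ∀ x ∈ Icc (0:ℝ) 1, 0 ≤ u₁ x := by
  obtain ⟨M, hM⟩ := isCompact_Icc.exists_bound_of_continuousOn
    (fun x hx => (hu.deriv_one x hx).continuousWithinAt)
  have hMpos : 0 ≤ M := (norm_nonneg _).trans (hM 0 (left_mem_Icc.2 zero_le_one))
  obtain ⟨h, hh, hMh⟩ : ∃ h : ℝ, 0 < h ∧ M * h ≤ u₀ 0 := by
    refine ⟨u₀ 0 / (M + 1), by positivity, ?_⟩
    rw [mul_div_assoc', div_le_iff₀ (by positivity)]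
    nlinarith
  have key (n : ℕ) : ∀ x ∈ Icc (0:ℝ) 1, x ≤ n * h → 0 ≤ u₁ x := by
    induction n with
    | zero =>
      intro x hx hxn
      obtain rfl : x = 0 := le_antisymm (by simpa using hxn) hx.1
      exact h₁
    | succ n ih =>
      have third : ∀ t ∈ Icc (0:ℝ) 1, t ≤ (n + 1 : ℕ) * h → 0 ≤ u₃ t := by
        intro t ht htn
        have hs : 0 ≤ min t (n * h) := le_min ht.1 (by positivity)
        have hts : t - min t (n * h) ≤ h := by
          push_cast at htn
          rcases min_cases t (n * h) with ⟨e, -⟩ | ⟨e, -⟩ <;> rw [e] <;> linarith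
        have hb := hu.third_deriv_lower_bound hlam hmono hP0 h₃ hMpos hs (min_le_left _ _) ht.2
          (fun x hx => ih x ⟨hx.1, hx.2.trans ((min_le_left _ _).trans ht.2)⟩
            (hx.2.trans (min_le_right _ _)))
          (fun x hx => (abs_le.1 (hM x ⟨hs.trans hx.1, hx.2.trans ht.2⟩)).1)
        have hPt : 0 ≤ P t := hP0 ▸ hmono (left_mem_Icc.2 zero_le_one) ht ht.1
        refine le_trans (mul_nonneg (mul_nonneg hlam hPt) ?_) hb
        nlinarith
      have second : ∀ t ∈ Icc (0:ℝ) 1, t ≤ (n + 1 : ℕ) * h → 0 ≤ u₂ t := fun t ht htn =>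
        h₂ ▸ le_of_hasDerivWithinAt_Icc_nonneg hu.deriv_two le_rfl ht.1 ht.2
          fun x hx => third x ⟨hx.1, hx.2.trans ht.2⟩ (hx.2.trans htn)
      exact fun t ht htn =>
        h₁.trans <| le_of_hasDerivWithinAt_Icc_nonneg hu.deriv_one le_rfl ht.1 ht.2
          fun x hx => second x ⟨hx.1, hx.2.trans ht.2⟩ (hx.2.trans htn)
  intro x hx
  obtain ⟨n, hn⟩ := exists_nat_gt (x / h)
  exact key n x hx ((div_lt_iff₀ hh).1 hn).le

/-- A solution with vanishing second derivative at `0` that satisfies three of the boundary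
conditions cannot start from a positive value. -/
theorem initial_value_nonpos (hu : IsSystemSolution P lam u₀ u₁ u₂ u₃) (hlam : 0 < lam)
    (hmono : MonotoneOn P (Icc 0 1)) (hP0 : P 0 = 0) (hP1 : P 1 = 1)
    {α β : ℝ} (hα : 0 ≤ α) (hβ : 0 < β) (h₂ : u₂ 0 = 0)
    (b₁ : u₂ 0 + α * u₀ 0 - β * u₁ 0 = 0) (b₂ : -β * u₃ 0 + α * u₂ 0 = 0)
    (b₄ : -β * u₃ 1 - α * u₂ 1 = 0) : u₀ 0 ≤ 0 := by
  by_contra! h₀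
  have h₃ : u₃ 0 = 0 := by
    rw [h₂, mul_zero, add_zero] at b₂
    exact (mul_eq_zero.1 b₂).resolve_left (neg_ne_zero.2 hβ.ne')
  have h₁ : 0 ≤ u₁ 0 := by
    refine nonneg_of_mul_nonneg_right (?_ : 0 ≤ β * u₁ 0) hβ
    nlinarith [mul_nonneg hα h₀.le]
  have hslope := hu.first_deriv_nonneg hlam.le hmono hP0 h₀ h₁ h₂ h₃
  have third : ∀ t ∈ Icc (0:ℝ) 1, lam * P t * u₀ 0 ≤ u₃ t := fun t ht => by
    have hb := hu.third_deriv_lower_bound hlam.le hmono hP0 h₃ le_rfl ht.1 le_rfl ht.2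
      (fun x hx => hslope x ⟨hx.1, hx.2.trans ht.2⟩)
      (fun x hx => by simpa using hslope x ⟨ht.1.trans hx.1, hx.2.trans ht.2⟩)
    simpa using hb
  have hu₂ : 0 ≤ u₂ 1 := h₂ ▸
    le_of_hasDerivWithinAt_Icc_nonneg hu.deriv_two le_rfl zero_le_one le_rfl fun x hx =>
      le_trans (mul_nonneg (mul_nonneg hlam.le
        (hP0 ▸ hmono (left_mem_Icc.2 zero_le_one) hx hx.1)) h₀.le) (third x hx)
  have hu₃ : 0 < u₃ 1 :=
    lt_of_lt_of_le (by rw [hP1]; positivity) (third 1 (right_mem_Icc.2 zero_le_one))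
  nlinarith [mul_pos hβ hu₃, mul_nonneg hα hu₂]

/-- A solution satisfying the boundary conditions whose second derivative vanishes at `0` is
trivial. -/
theorem eq_zero_of_boundary (hu : IsSystemSolution P lam u₀ u₁ u₂ u₃) (hlam : 0 < lam)
    (hmono : MonotoneOn P (Icc 0 1)) (hP0 : P 0 = 0) (hP1 : P 1 = 1)
    {α β : ℝ} (hα : 0 ≤ α) (hβ : 0 < β) (h₂ : u₂ 0 = 0)
    (b₁ : u₂ 0 + α * u₀ 0 - β * u₁ 0 = 0) (b₂ : -β * u₃ 0 + α * u₂ 0 = 0)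
    (b₄ : -β * u₃ 1 - α * u₂ 1 = 0) : ∀ x ∈ Icc (0:ℝ) 1, u₀ x = 0 := by
  have hle := hu.initial_value_nonpos hlam hmono hP0 hP1 hα hβ h₂ b₁ b₂ b₄
  have hge := hu.neg.initial_value_nonpos hlam hmono hP0 hP1 hα hβ (by simp [h₂])
    (by linarith) (by linarith) (by linarith)
  have h₀ : u₀ 0 = 0 := le_antisymm hle (by linarith)
  have h₁ : u₁ 0 = 0 := by simpa [h₀, h₂, hβ.ne'] using b₁
  have h₃ : u₃ 0 = 0 := by simpa [h₂, hβ.ne'] using b₂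
  refine hu.eq_zero_of_initial hlam.le (fun x hx => ⟨?_, ?_⟩) h₀ h₁ h₂ h₃
  · exact hP0 ▸ hmono (left_mem_Icc.2 zero_le_one) hx hx.1
  · exact hP1 ▸ hmono hx (right_mem_Icc.2 zero_le_one) hx.2

end IsSystemSolution

theorem stmt5 (P : ℝ → ℝ) (κ : ℕ) (a : ℝ) (hP : CantorSelfSimilar P κ a)
    (α β : ℝ) (hα : 0 ≤ α) (hβ : 0 < β)
    (lam : ℝ) (hlam : 0 < lam) (y z : ℝ → ℝ)
    (hy : Eigenfunction P α β lam y) (hz : Eigenfunction P α β lam z) :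
    ∃ c : ℝ, (∀ x ∈ Set.Icc (0:ℝ) 1, z x = c * y x) ∨
      (∀ x ∈ Set.Icc (0:ℝ) 1, y x = c * z x) := by
  obtain ⟨-, hmono, hP0, hP1, -⟩ := hP
  obtain ⟨⟨x₀, hx₀, hyx₀⟩, hys, y₁, y₂, -, y₄⟩ := hy
  obtain ⟨-, hzs, z₁, z₂, -, z₄⟩ := hz
  have hy₂ : Y2 y 0 ≠ 0 := fun h =>
    hyx₀ (hys.isSystemSolution.eq_zero_of_boundary hlam hmono hP0 hP1 hα hβ h y₁ y₂ y₄ x₀ hx₀)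
  set c := Y2 z 0 / Y2 y 0 with hc
  have hdiff := (hzs.isSystemSolution.sub_const_mul hys.isSystemSolution c).eq_zero_of_boundary
    hlam hmono hP0 hP1 hα hβ (by rw [hc, div_mul_cancel₀ _ hy₂, sub_self])
    (by linear_combination z₁ - c * y₁) (by linear_combination z₂ - c * y₂)
    (by linear_combination z₄ - c * y₄)
  exact ⟨c, Or.inl fun x hx => sub_eq_zero.1 (hdiff x hx)⟩
end
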